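/- arXiv:2312.03959 — 2 statements merged into one kernel-verified Lean document; each statement's English description precedes it below -/
import Mathlib

section
/- Let K be a field, Λ a τ-tilting finite finite-dimensional K-algebra, and let 𝒯 and 𝒯′ be torsion classes of finite-dimensional right Λ-modules. Then pop↓(𝒯′) = 𝒯 in the finite lattice tors Λ if and only if both of the following hold: (1) every module in 𝒟(𝒯′) is isomorphic to a module in 𝒰(𝒯); and (2) for every X ∈ 𝒟(𝒯), there exists a module Z ∈ Filt(𝒟(𝒯′)) admitting a surjective Λ-module homomorphism Z ↠ X. -/
namespace PaperTors

universe u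

variable (K : Type u) [Field K] (Λ : Type u) [Ring Λ] [Algebra K Λ]

/-- The category of finite-dimensional right `Λ`-modules is modeled as bundled left modules over
the opposite algebra `Λᵐᵒᵖ` (a right `Λ`-module is the same thing as a left `Λᵐᵒᵖ`-module). -/
abbrev RMod := ModuleCat.{u} Λᵐᵒᵖ

/-- `M` is finite-dimensional over `K` (with the `K`-action obtained through the algebra map
`K → Λᵐᵒᵖ`). -/
def IsFinDim (M : RMod Λ) : Prop :=
  letI : Module K M := Module.compHom M (algebraMap K Λᵐᵒᵖ)
  FiniteDimensional K M

/-- `𝒯` is a torsion class of finite-dimensional right `Λ`-modules: a class of modules, closed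
under isomorphism, consisting of finite-dimensional modules, containing the zero module, and
closed under quotient modules and under extensions. -/
structure IsTorsionClass (𝒯 : Set (RMod Λ)) : Prop where
  iso_closed : ∀ M N : RMod Λ, (M ≃ₗ[Λᵐᵒᵖ] N) → M ∈ 𝒯 → N ∈ 𝒯
  finDim : ∀ M ∈ 𝒯, IsFinDim K Λ M
  zero_mem : ∀ M : RMod Λ, Subsingleton M → M ∈ 𝒯
  quot_closed : ∀ (M N : RMod Λ) (f : M →ₗ[Λᵐᵒᵖ] N), Function.Surjective f → M ∈ 𝒯 → N ∈ 𝒯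
  ext_closed : ∀ (M : RMod Λ) (A : Submodule Λᵐᵒᵖ M),
    ModuleCat.of Λᵐᵒᵖ A ∈ 𝒯 → ModuleCat.of Λᵐᵒᵖ (M ⧸ A) ∈ 𝒯 → M ∈ 𝒯

/-- The lattice of torsion classes `tors Λ`, ordered by inclusion. -/
def TorsionClass : Type (u + 1) := {𝒯 : Set (RMod Λ) // IsTorsionClass K Λ 𝒯}

instance : PartialOrder (TorsionClass K Λ) := Subtype.partialOrder _

/-- `y` is the image of `x` under the pop-stack operator: `y` is the meet (the greatest lower
bound) of the set consisting of `x` together with all elements covered by `x`. -/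
def IsPopDown {α : Type*} [PartialOrder α] (x y : α) : Prop :=
  IsGLB (insert x {z | z ⋖ x}) y

/-- `y` is the image of `x` under the dual pop-stack operator: `y` is the join (the least upper
bound) of the set consisting of `x` together with all elements covering `x`. -/
def IsPopUp {α : Type*} [PartialOrder α] (x y : α) : Prop :=
  IsLUB (insert x {z | x ⋖ z}) y

variable {K}

/-- `W_L(𝒯)`: modules `M ∈ 𝒯` such that the kernel of any homomorphism from a module of `𝒯`
to `M` again lies in `𝒯`. -/
def WLower (𝒯 : Set (RMod Λ)) : Set (RMod Λ) :=
  {M | M ∈ 𝒯 ∧ ∀ N : RMod Λ, N ∈ 𝒯 → ∀ f : N →ₗ[Λᵐᵒᵖ] M,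
    ModuleCat.of Λᵐᵒᵖ (LinearMap.ker f) ∈ 𝒯}

/-- `𝒟(𝒯)`: the nonzero modules of `W_L(𝒯)` having no proper nonzero submodule belonging to
`W_L(𝒯)` (the brick labels of the cover relations below `𝒯`). -/
def DSet (𝒯 : Set (RMod Λ)) : Set (RMod Λ) :=
  {M | M ∈ WLower Λ 𝒯 ∧ (∃ m : M, m ≠ 0) ∧
    ∀ N : Submodule Λᵐᵒᵖ M, ModuleCat.of Λᵐᵒᵖ N ∈ WLower Λ 𝒯 → N = ⊥ ∨ N = ⊤}

/-- `𝒯⊥`: the modules admitting no nonzero homomorphism from any module of `𝒯`. -/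
def Perp (𝒯 : Set (RMod Λ)) : Set (RMod Λ) :=
  {M | ∀ T : RMod Λ, T ∈ 𝒯 → ∀ f : T →ₗ[Λᵐᵒᵖ] M, f = 0}

/-- `W_U(𝒯)`: modules `M ∈ 𝒯⊥` such that the cokernel of any homomorphism from `M` to a module
of `𝒯⊥` again lies in `𝒯⊥`. -/
def WUpper (𝒯 : Set (RMod Λ)) : Set (RMod Λ) :=
  {M | M ∈ Perp Λ 𝒯 ∧ ∀ N : RMod Λ, N ∈ Perp Λ 𝒯 → ∀ f : M →ₗ[Λᵐᵒᵖ] N,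
    ModuleCat.of Λᵐᵒᵖ (N ⧸ LinearMap.range f) ∈ Perp Λ 𝒯}

/-- `𝒰(𝒯)`: the nonzero modules of `W_U(𝒯)` having no proper nonzero submodule belonging to
`W_U(𝒯)` (the brick labels of the cover relations above `𝒯`). -/
def USet (𝒯 : Set (RMod Λ)) : Set (RMod Λ) :=
  {M | M ∈ WUpper Λ 𝒯 ∧ (∃ m : M, m ≠ 0) ∧
    ∀ N : Submodule Λᵐᵒᵖ M, ModuleCat.of Λᵐᵒᵖ N ∈ WUpper Λ 𝒯 → N = ⊥ ∨ N = ⊤}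

/-- `Filt(𝒞)`: modules admitting a finite filtration by submodules whose successive quotients
are isomorphic to modules in `𝒞`. -/
def FiltSet (𝒞 : Set (RMod Λ)) : Set (RMod Λ) :=
  {M | ∃ (r : ℕ) (c : Fin (r + 1) → Submodule Λᵐᵒᵖ M), Monotone c ∧
    c 0 = ⊥ ∧ c (Fin.last r) = ⊤ ∧
    ∀ i : Fin r, ∃ C ∈ 𝒞, Nonempty
      ((↥(c i.succ) ⧸ Submodule.comap (c i.succ).subtype (c i.castSucc)) ≃ₗ[Λᵐᵒᵖ] C)}



section Helpers

variable {Λ}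

/-- Membership of an unbundled module in a class of bundled modules. -/
def In (T : Set (RMod Λ)) (M : Type u) [AddCommGroup M] [Module Λᵐᵒᵖ M] : Prop :=
  ModuleCat.of Λᵐᵒᵖ M ∈ T

/-- Unbundled version of `WLower`. -/
def WL (T : Set (RMod Λ)) (M : Type u) [AddCommGroup M] [Module Λᵐᵒᵖ M] : Prop :=
  In T M ∧ ∀ (N : Type u) [AddCommGroup N] [Module Λᵐᵒᵖ N], In T N → ∀ f : N →ₗ[Λᵐᵒᵖ] M,
    In T (LinearMap.ker f)

/-- Unbundled version of `Perp`. -/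
def PP (T : Set (RMod Λ)) (M : Type u) [AddCommGroup M] [Module Λᵐᵒᵖ M] : Prop :=
  ∀ (N : Type u) [AddCommGroup N] [Module Λᵐᵒᵖ N], In T N → ∀ f : N →ₗ[Λᵐᵒᵖ] M, f = 0

/-- Unbundled version of `WUpper`. -/
def WU (T : Set (RMod Λ)) (M : Type u) [AddCommGroup M] [Module Λᵐᵒᵖ M] : Prop :=
  PP T M ∧ ∀ (N : Type u) [AddCommGroup N] [Module Λᵐᵒᵖ N], PP T N → ∀ f : M →ₗ[Λᵐᵒᵖ] N,
    PP T (N ⧸ LinearMap.range f)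

theorem mem_iff_In (T : Set (RMod Λ)) (M : RMod Λ) : M ∈ T ↔ In T M := Iff.rfl

theorem mem_Perp_iff (T : Set (RMod Λ)) (M : RMod Λ) : M ∈ Perp Λ T ↔ PP T M :=
  ⟨fun h N _ _ hN f => h (ModuleCat.of Λᵐᵒᵖ N) hN f, fun h N hN f => h N hN f⟩

theorem mem_WLower_iff (T : Set (RMod Λ)) (M : RMod Λ) : M ∈ WLower Λ T ↔ WL T M :=
  ⟨fun h => ⟨h.1, fun N _ _ hN f => h.2 (ModuleCat.of Λᵐᵒᵖ N) hN f⟩,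
    fun h => ⟨h.1, fun N hN f => h.2 N hN f⟩⟩

theorem mem_WUpper_iff (T : Set (RMod Λ)) (M : RMod Λ) : M ∈ WUpper Λ T ↔ WU T M :=
  ⟨fun h => ⟨(mem_Perp_iff T M).1 h.1, fun N _ _ hN f =>
      (mem_Perp_iff T _).1 (h.2 (ModuleCat.of Λᵐᵒᵖ N) ((mem_Perp_iff T _).2 hN) f)⟩,
    fun h => ⟨(mem_Perp_iff T M).2 h.1, fun N hN f =>
      (mem_Perp_iff T _).2 (h.2 N ((mem_Perp_iff T _).1 hN) f)⟩⟩

section Basic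

variable {T : Set (RMod Λ)} (hT : IsTorsionClass K Λ T)
variable {M N : Type u} [AddCommGroup M] [Module Λᵐᵒᵖ M] [AddCommGroup N] [Module Λᵐᵒᵖ N]

include hT

theorem In_surj (h : In T M) (f : M →ₗ[Λᵐᵒᵖ] N) (hf : Function.Surjective f) : In T N :=
  hT.quot_closed (ModuleCat.of Λᵐᵒᵖ M) (ModuleCat.of Λᵐᵒᵖ N) f hf h

theorem In_equiv (h : In T M) (e : M ≃ₗ[Λᵐᵒᵖ] N) : In T N :=
  In_surj hT h e.toLinearMap e.surjective

theorem In_range (h : In T M) (f : M →ₗ[Λᵐᵒᵖ] N) : In T (LinearMap.range f) :=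
  In_surj hT h f.rangeRestrict f.surjective_rangeRestrict

theorem In_quot (h : In T M) (L : Submodule Λᵐᵒᵖ M) : In T (M ⧸ L) :=
  In_surj hT h L.mkQ L.mkQ_surjective

theorem In_zero (h : Subsingleton M) : In T M := hT.zero_mem (ModuleCat.of Λᵐᵒᵖ M) h

theorem In_bot : In T (⊥ : Submodule Λᵐᵒᵖ M) := In_zero hT inferInstance

theorem In_top (h : In T M) : In T (⊤ : Submodule Λᵐᵒᵖ M) :=
  In_equiv hT h Submodule.topEquiv.symm

theorem In_ext (L : Submodule Λᵐᵒᵖ M) (h1 : In T L) (h2 : In T (M ⧸ L)) : In T M :=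
  hT.ext_closed (ModuleCat.of Λᵐᵒᵖ M) L h1 h2

theorem In_ext' (f : M →ₗ[Λᵐᵒᵖ] N) (h1 : In T (LinearMap.ker f))
    (h2 : In T (LinearMap.range f)) : In T M :=
  In_ext hT (LinearMap.ker f) h1 (In_equiv hT h2 f.quotKerEquivRange.symm)

/-- The preimage of a submodule in `T` under a projection with kernel in `T` is in `T`. -/
theorem In_comap (L : Submodule Λᵐᵒᵖ M) (h1 : In T L) (U : Submodule Λᵐᵒᵖ (M ⧸ L))
    (h2 : In T U) : In T (U.comap L.mkQ) := by
  have hL : L ≤ U.comap L.mkQ := by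
    intro x hx
    have : L.mkQ x = 0 := by simpa using hx
    simp [Submodule.mem_comap, this]
  let h : (U.comap L.mkQ) →ₗ[Λᵐᵒᵖ] M ⧸ L := L.mkQ ∘ₗ (U.comap L.mkQ).subtype
  refine In_ext' hT h ?_ ?_
  · have : LinearMap.ker h = L.comap (U.comap L.mkQ).subtype := by
      rw [LinearMap.ker_comp, Submodule.ker_mkQ]
    rw [this]
    exact In_equiv hT h1 (Submodule.comapSubtypeEquivOfLe hL).symm
  · have : LinearMap.range h = U := by
      rw [LinearMap.range_comp, Submodule.range_subtype, Submodule.map_comap_eq,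
        Submodule.range_mkQ, top_inf_eq]
    rw [this]
    exact h2

theorem In_fin (h : In T M) : IsNoetherian Λᵐᵒᵖ M ∧ IsArtinian Λᵐᵒᵖ M := by
  have h1 := hT.finDim _ h
  let _ : Module K M := Module.compHom M (algebraMap K Λᵐᵒᵖ)
  have : FiniteDimensional K M := h1
  have : IsScalarTower K Λᵐᵒᵖ M := ⟨fun a b m => by
    change (a • b) • m = (algebraMap K Λᵐᵒᵖ a) • (b • m)
    rw [Algebra.smul_def, mul_smul]⟩
  exact ⟨isNoetherian_of_tower K inferInstance, isArtinian_of_tower K inferInstance⟩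

/-! ### Perp -/

omit hT in
theorem PP_inj (h : PP T N) (f : M →ₗ[Λᵐᵒᵖ] N) (hf : Function.Injective f) : PP T M := by
  intro X _ _ hX g
  have := h X hX (f ∘ₗ g)
  ext x
  apply hf
  simpa using LinearMap.congr_fun this x

omit hT in
theorem PP_ext (f : M →ₗ[Λᵐᵒᵖ] N) (h1 : PP T (LinearMap.ker f)) (h2 : PP T N) : PP T M := by
  intro X _ _ hX g
  have h := h2 X hX (f ∘ₗ g)
  have h3 := h1 X hX (g.codRestrict (LinearMap.ker f) (fun x => by
    simpa using LinearMap.congr_fun h x))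
  ext x
  have := LinearMap.congr_fun h3 x
  simpa using congrArg Subtype.val this

/-- Existence of the torsion submodule. -/
theorem exists_torsion_sub [IsNoetherian Λᵐᵒᵖ M] :
    ∃ L : Submodule Λᵐᵒᵖ M, In T L ∧ PP T (M ⧸ L) := by
  obtain ⟨L, hL, hmax⟩ := set_has_maximal_iff_noetherian.2 (inferInstance : IsNoetherian Λᵐᵒᵖ M)
    {L : Submodule Λᵐᵒᵖ M | In T L} ⟨⊥, In_bot hT⟩
  refine ⟨L, hL, ?_⟩
  intro X _ _ hX g
  have h1 := In_comap hT L hL _ (In_range hT hX g)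
  have h2 : L ≤ (LinearMap.range g).comap L.mkQ := by
    intro x hx
    have : L.mkQ x = 0 := by simpa using hx
    simp [Submodule.mem_comap, this]
  have h3 : (LinearMap.range g).comap L.mkQ = L :=
    ((h2.lt_or_eq).resolve_left (hmax _ h1)).symm
  ext x
  obtain ⟨m, hm⟩ := L.mkQ_surjective (g x)
  have : m ∈ (LinearMap.range g).comap L.mkQ := by
    rw [Submodule.mem_comap, hm]; exact ⟨x, rfl⟩
  rw [h3] at this
  rw [← hm]
  simpa using this

/-! ### WL -/

omit hT in
theorem WL_sub (h : WL T M) (L : Submodule Λᵐᵒᵖ M) (hL : In T L) : WL T L := by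
  refine ⟨hL, fun N _ _ hN f => ?_⟩
  have := h.2 N hN (L.subtype ∘ₗ f)
  rwa [LinearMap.ker_comp_of_ker_eq_bot _ L.ker_subtype] at this

theorem WL_equiv (h : WL T M) (e : M ≃ₗ[Λᵐᵒᵖ] N) : WL T N := by
  refine ⟨In_equiv hT h.1 e, fun A _ _ hA f => ?_⟩
  have := h.2 A hA (e.symm.toLinearMap ∘ₗ f)
  rwa [LinearMap.ker_comp_of_ker_eq_bot _ e.symm.ker] at this

theorem WL_quot (h : WL T M) (L : Submodule Λᵐᵒᵖ M) (hL : In T L) : WL T (M ⧸ L) := by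
  refine ⟨In_quot hT h.1 L, fun A _ _ hA f => ?_⟩
  let d : (A × M) →ₗ[Λᵐᵒᵖ] (M ⧸ L) :=
    f ∘ₗ LinearMap.fst Λᵐᵒᵖ A M - L.mkQ ∘ₗ LinearMap.snd Λᵐᵒᵖ A M
  have hd : ∀ x, x ∈ LinearMap.ker d ↔ f x.1 = L.mkQ x.2 := by
    intro x
    simp [d, sub_eq_zero]
  let p : LinearMap.ker d →ₗ[Λᵐᵒᵖ] A := LinearMap.fst Λᵐᵒᵖ A M ∘ₗ (LinearMap.ker d).subtype
  let q : LinearMap.ker d →ₗ[Λᵐᵒᵖ] M := LinearMap.snd Λᵐᵒᵖ A M ∘ₗ (LinearMap.ker d).subtype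
  have hp : In T (LinearMap.ker d) := by
    refine In_ext' hT p ?_ ?_
    · let k : L →ₗ[Λᵐᵒᵖ] LinearMap.ker p := LinearMap.codRestrict _
        (LinearMap.codRestrict (LinearMap.ker d) (LinearMap.inr Λᵐᵒᵖ A M ∘ₗ L.subtype) (by
          intro x; rw [hd]; simp [eq_comm (a := (0 : _ ⧸ _))])) (by intro x; simp [p])
      refine In_surj hT hL k ?_
      rintro ⟨⟨⟨a, m⟩, hx⟩, hy⟩
      have ha : a = 0 := by simpa [p] using hy
      have hm : m ∈ L := by
        have := (hd _).1 hx
        rw [ha, map_zero] at this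
        simpa using this.symm
      refine ⟨⟨m, hm⟩, ?_⟩
      subst ha
      rfl
    · have : LinearMap.range p = ⊤ := by
        rw [LinearMap.range_eq_top]
        intro a
        obtain ⟨m, hm⟩ := L.mkQ_surjective (f a)
        exact ⟨⟨(a, m), (hd _).2 hm.symm⟩, rfl⟩
      rw [this]
      exact In_top hT hA
  have hq := h.2 _ hp q
  let k : LinearMap.ker q →ₗ[Λᵐᵒᵖ] LinearMap.ker f :=
    LinearMap.codRestrict _ (p ∘ₗ (LinearMap.ker q).subtype) (by
      rintro ⟨⟨⟨a, m⟩, hx⟩, hy⟩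
      have hm : m = 0 := by simpa [q] using hy
      have := (hd _).1 hx
      simpa [hm, p] using this)
  refine In_surj hT hq k ?_
  rintro ⟨a, ha⟩
  have ha' : f a = 0 := ha
  exact ⟨⟨⟨(a, 0), (hd _).2 (by simp [ha'])⟩, by simp [q]⟩, rfl⟩

theorem WL_ext (L : Submodule Λᵐᵒᵖ M) (h1 : WL T L) (h2 : WL T (M ⧸ L)) : WL T M := by
  refine ⟨In_ext hT L h1.1 h2.1, fun A _ _ hA f => ?_⟩
  have h3 := h2.2 A hA (L.mkQ ∘ₗ f)
  let g : LinearMap.ker (L.mkQ ∘ₗ f) →ₗ[Λᵐᵒᵖ] L :=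
    LinearMap.codRestrict L (f ∘ₗ (LinearMap.ker (L.mkQ ∘ₗ f)).subtype) (by
      rintro ⟨a, ha⟩
      simpa using ha)
  have h4 := h1.2 _ h3 g
  let k : LinearMap.ker g →ₗ[Λᵐᵒᵖ] LinearMap.ker f :=
    LinearMap.codRestrict _ ((LinearMap.ker (L.mkQ ∘ₗ f)).subtype ∘ₗ (LinearMap.ker g).subtype) (by
      rintro ⟨⟨a, ha⟩, hb⟩
      have := congrArg Subtype.val (LinearMap.mem_ker.1 hb)
      simpa [g] using this)
  refine In_surj hT h4 k ?_
  rintro ⟨a, ha⟩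
  have ha' : f a = 0 := ha
  refine ⟨⟨⟨a, by simp [ha']⟩, ?_⟩, rfl⟩
  rw [LinearMap.mem_ker]
  ext
  simpa [g] using ha'

end Basic

/-- Unbundled version of `DSet`. -/
def DD (T : Set (RMod Λ)) (M : Type u) [AddCommGroup M] [Module Λᵐᵒᵖ M] : Prop :=
  WL T M ∧ (∃ m : M, m ≠ 0) ∧ ∀ N : Submodule Λᵐᵒᵖ M, In T N → N = ⊥ ∨ N = ⊤

theorem mem_DSet_iff (T : Set (RMod Λ)) (M : RMod Λ) : M ∈ DSet Λ T ↔ DD T M := by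
  constructor
  · rintro ⟨h1, h2, h3⟩
    have h1' := (mem_WLower_iff T M).1 h1
    exact ⟨h1', h2, fun N hN => h3 N ((mem_WLower_iff T _).2 (WL_sub h1' N hN))⟩
  · rintro ⟨h1, h2, h3⟩
    exact ⟨(mem_WLower_iff T M).2 h1, h2, fun N hN => h3 N ((mem_WLower_iff T _).1 hN).1⟩

/-- Torsion class cut out of `T` by left-orthogonality to `S`. -/
def restr (T S : Set (RMod Λ)) : Set (RMod Λ) :=
  {M | M ∈ T ∧ ∀ Y ∈ S, ∀ f : M →ₗ[Λᵐᵒᵖ] Y, f = 0}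

theorem restr_tors {T : Set (RMod Λ)} (hT : IsTorsionClass K Λ T) (S : Set (RMod Λ)) :
    IsTorsionClass K Λ (restr T S) := by
  have hq : ∀ (M N : RMod Λ) (f : M →ₗ[Λᵐᵒᵖ] N), Function.Surjective f →
      M ∈ restr T S → N ∈ restr T S := by
    intro M N f hf hM
    refine ⟨hT.quot_closed M N f hf hM.1, fun Y hY g => ?_⟩
    have := hM.2 Y hY (g ∘ₗ f)
    ext x
    obtain ⟨y, rfl⟩ := hf x
    simpa using LinearMap.congr_fun this y
  refine ⟨fun M N e hM => hq M N e.toLinearMap e.surjective hM, fun M hM => hT.finDim M hM.1,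
    fun M hM => ⟨hT.zero_mem M hM, fun Y _ f => ?_⟩, hq, ?_⟩
  · ext x
    rw [Subsingleton.elim x 0]; simp
  · intro M A h1 h2
    refine ⟨hT.ext_closed M A h1.1 h2.1, fun Y hY f => ?_⟩
    have h3 : f ∘ₗ A.subtype = 0 := h1.2 Y hY _
    have h4 : A.liftQ f (fun x hx => by
        simpa using LinearMap.congr_fun h3 ⟨x, hx⟩) = 0 := h2.2 Y hY _
    ext x
    have := LinearMap.congr_fun h4 (A.mkQ x)
    simpa using this

section Tors

variable {T : Set (RMod Λ)} (hT : IsTorsionClass K Λ T)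

include hT

theorem DD_iso {A B : Type u} [AddCommGroup A] [Module Λᵐᵒᵖ A] [AddCommGroup B] [Module Λᵐᵒᵖ B]
    (hA : DD T A) (hB : DD T B) (f : A →ₗ[Λᵐᵒᵖ] B) (hf : f ≠ 0) : Function.Bijective f := by
  constructor
  · rw [← LinearMap.ker_eq_bot]
    refine (hA.2.2 _ (hB.1.2 A hA.1.1 f)).resolve_right fun h => hf (LinearMap.ker_eq_top.1 h)
  · rw [← LinearMap.range_eq_top]
    refine (hB.2.2 _ (In_range hT hA.1.1 f)).resolve_left fun h => hf (LinearMap.range_eq_bot.1 h)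

/-- A lower cover of `T` is orthogonal to some element of `𝒟(T)`. -/
theorem cover_label {C : Set (RMod Λ)} (hC : IsTorsionClass K Λ C)
    (hcov : (⟨C, hC⟩ : TorsionClass K Λ) ⋖ ⟨T, hT⟩) :
    ∃ (B : Type u) (_ : AddCommGroup B) (_ : Module Λᵐᵒᵖ B), DD T B ∧ PP C B := by
  have hCT : C ⊆ T := hcov.1.le
  have hnot : ¬ T ⊆ C := hcov.1.not_ge
  obtain ⟨M, hMT, hMC⟩ := Set.not_subset.1 hnot
  have hMT' : In T M := hMT
  have := (In_fin hT hMT').1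
  obtain ⟨L, hL, hPL⟩ := exists_torsion_sub hC (M := M)
  have hQT : In T (M ⧸ L) := In_quot hT hMT' L
  have := (In_fin hT hQT).2
  have hQ0 : (⊤ : Submodule Λᵐᵒᵖ (M ⧸ L)) ≠ ⊥ := by
    intro h
    apply hMC
    refine In_ext hC L hL (In_zero hC ?_)
    exact (Submodule.subsingleton_iff Λᵐᵒᵖ).1 (subsingleton_of_bot_eq_top h.symm)
  obtain ⟨B, ⟨hBT, hB0⟩, hmin⟩ := set_has_minimal_iff_artinian.2
    (inferInstance : IsArtinian Λᵐᵒᵖ (M ⧸ L))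
    {B : Submodule Λᵐᵒᵖ (M ⧸ L) | In T B ∧ B ≠ ⊥} ⟨⊤, In_top hT hQT, hQ0⟩
  have hBC : PP C B := PP_inj hPL B.subtype B.subtype_injective
  have hsub : ∀ N : Submodule Λᵐᵒᵖ B, In T N → N = ⊥ ∨ N = ⊤ := by
    intro N hN
    by_contra hcon
    push Not at hcon
    refine hmin (N.map B.subtype) ⟨?_, ?_⟩ ?_
    · exact In_equiv hT hN (Submodule.equivMapOfInjective _ B.subtype_injective N)
    · intro h
      apply hcon.1
      rw [eq_bot_iff]
      intro x hx
      have : (x : M ⧸ L) ∈ N.map B.subtype := ⟨x, hx, rfl⟩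
      rw [h] at this
      simpa using this
    · refine lt_of_le_of_ne (Submodule.map_subtype_le B N) fun h => hcon.2 ?_
      rw [eq_top_iff]
      rintro ⟨x, hx⟩ -
      rw [← h] at hx
      obtain ⟨y, hy, hyx⟩ := hx
      have : y = ⟨x, by rw [← hyx]; exact y.2⟩ := Subtype.ext hyx
      rwa [this] at hy
  have hBne : ∃ b : B, b ≠ 0 := by
    obtain ⟨x, hx, hx0⟩ := Submodule.exists_mem_ne_zero_of_ne_bot hB0
    exact ⟨⟨x, hx⟩, fun h => hx0 (congrArg Subtype.val h)⟩
  have hBnC : ¬ In C B := by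
    intro h
    obtain ⟨b, hb⟩ := hBne
    exact hb (LinearMap.congr_fun (hBC B h LinearMap.id) b)
  -- every nonzero module of `T ∩ C⊥` receives a nonzero map from `B`
  have hmap : ∀ (N : Type u) [AddCommGroup N] [Module Λᵐᵒᵖ N], In T N → PP C N →
      (∀ g : B →ₗ[Λᵐᵒᵖ] N, g = 0) → ∀ x : N, x = 0 := by
    intro N _ _ hN hNC hg
    let S : Set (RMod Λ) := {Y | PP C Y ∧ ∀ g : B →ₗ[Λᵐᵒᵖ] Y, g = 0}
    let G : TorsionClass K Λ := ⟨restr T S, restr_tors hT S⟩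
    have h1 : (⟨C, hC⟩ : TorsionClass K Λ) < G := by
      refine lt_of_le_not_ge (fun X hX => ⟨hCT hX, fun Y hY f => hY.1 X hX f⟩) fun h => hBnC ?_
      exact h (show ModuleCat.of Λᵐᵒᵖ B ∈ restr T S from ⟨hBT, fun Y hY f => hY.2 f⟩)
    have h2 : G ≤ ⟨T, hT⟩ := fun X hX => hX.1
    have h3 : (⟨T, hT⟩ : TorsionClass K Λ) ≤ G := by
      by_contra h
      exact hcov.2 h1 (lt_of_le_not_ge h2 h)
    have h4 : ModuleCat.of Λᵐᵒᵖ N ∈ restr T S := h3 hN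
    have h5 := h4.2 (ModuleCat.of Λᵐᵒᵖ N) ⟨hNC, hg⟩ LinearMap.id
    intro x
    exact LinearMap.congr_fun h5 x
  refine ⟨B, inferInstance, inferInstance, ⟨⟨hBT, ?_⟩, hBne, hsub⟩, hBC⟩
  intro N _ _ hN f
  rcases hsub _ (In_range hT hN f) with h | h
  · rw [LinearMap.range_eq_bot.1 h, LinearMap.ker_zero]
    exact In_top hT hN
  have hfs : Function.Surjective f := LinearMap.range_eq_top.1 h
  -- torsion part of the kernel
  have := (In_fin hT hN).1
  obtain ⟨A, hA, hPA⟩ := exists_torsion_sub hT (M := LinearMap.ker f)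
  let A' : Submodule Λᵐᵒᵖ N := A.map (LinearMap.ker f).subtype
  have hA'k : A' ≤ LinearMap.ker f := Submodule.map_subtype_le _ _
  have hA' : In T A' := In_equiv hT hA
    (Submodule.equivMapOfInjective _ (LinearMap.ker f).subtype_injective A)
  let f' : (N ⧸ A') →ₗ[Λᵐᵒᵖ] B := A'.liftQ f hA'k
  have hN' : In T (N ⧸ A') := In_quot hT hN A'
  have hf's : Function.Surjective f' := by
    intro b
    obtain ⟨n, hn⟩ := hfs b
    exact ⟨A'.mkQ n, by simpa [f'] using hn⟩
  -- the kernel of `f'` is torsion-free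
  have hker : PP T (LinearMap.ker f') := by
    let k : (LinearMap.ker f ⧸ A) →ₗ[Λᵐᵒᵖ] (N ⧸ A') :=
      A.mapQ A' (LinearMap.ker f).subtype (Submodule.le_comap_map _ _)
    have hk : ∀ y : LinearMap.ker f', ∃ z, k z = y.1 := by
      rintro ⟨y, hy⟩
      obtain ⟨n, rfl⟩ := A'.mkQ_surjective y
      exact ⟨A.mkQ ⟨n, by simpa [f'] using hy⟩, by simp [k]⟩
    have hkinj : Function.Injective k := by
      rw [← LinearMap.ker_eq_bot, LinearMap.ker_eq_bot']
      intro z hz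
      obtain ⟨z, rfl⟩ := A.mkQ_surjective z
      have hz' : (z : N) ∈ A' := by simpa [k] using hz
      obtain ⟨w, hw, hwz⟩ := hz'
      have : w = z := Subtype.ext hwz
      subst this
      simpa using hw
    intro X _ _ hX g
    let e := LinearEquiv.ofInjective k hkinj
    have hle : LinearMap.ker f' ≤ LinearMap.range k := fun y hy => hk ⟨y, hy⟩
    have := PP_inj hPA (e.symm.toLinearMap ∘ₗ Submodule.inclusion hle)
      (e.symm.injective.comp (Submodule.inclusion_injective hle))
    exact this X hX g
  have hN'C : PP C (N ⧸ A') := by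
    refine PP_ext f' ?_ hBC
    intro X _ _ hX g
    exact hker X (hCT hX) g
  have hex : ∃ g : B →ₗ[Λᵐᵒᵖ] (N ⧸ A'), g ≠ 0 := by
    by_contra hcon
    push Not at hcon
    have h0 := hmap _ hN' hN'C hcon
    obtain ⟨b, hb⟩ := hBne
    obtain ⟨y, rfl⟩ := hf's b
    rw [h0 y] at hb
    simp at hb
  obtain ⟨g, hg⟩ := hex
  have hfg : f' ∘ₗ g ≠ 0 := by
    intro h0
    have := hker B hBT (g.codRestrict _ (fun x => by simpa using LinearMap.congr_fun h0 x))
    apply hg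
    ext x
    simpa using congrArg Subtype.val (LinearMap.congr_fun this x)
  have hsurj : Function.Surjective (f' ∘ₗ g) := by
    rw [← LinearMap.range_eq_top]
    exact (hsub _ (In_range hT hBT _)).resolve_left fun h => hfg (LinearMap.range_eq_bot.1 h)
  -- `f'` restricted to the range of `g` is injective and onto, so the kernel is a quotient
  have := (In_fin hT hBT).1
  have hinj : Function.Injective (f' ∘ₗ g) :=
    IsNoetherian.injective_of_surjective_endomorphism _ hsurj
  let e : B ≃ₗ[Λᵐᵒᵖ] B := LinearEquiv.ofBijective (f' ∘ₗ g) ⟨hinj, hsurj⟩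
  have he : ∀ b, f' (g (e.symm b)) = b := fun b => e.apply_symm_apply b
  let r : (N ⧸ A') →ₗ[Λᵐᵒᵖ] LinearMap.ker f' :=
    LinearMap.codRestrict _ (LinearMap.id - g ∘ₗ e.symm.toLinearMap ∘ₗ f') (by
      intro x
      simp [he])
  have hr0 : r = 0 := hker _ hN' r
  have hkerb : ∀ y, f' y = 0 → y = 0 := by
    intro y hy
    have := congrArg Subtype.val (LinearMap.congr_fun hr0 y)
    simpa [r, hy] using this
  have : LinearMap.ker f = A' := by
    refine le_antisymm (fun n hn => ?_) hA'k
    have := hkerb (A'.mkQ n) (by simpa [f'] using hn)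
    simpa using this
  rw [this]
  exact hA'

variable [hfin : Finite (TorsionClass K Λ)]

theorem lt_label {C : Set (RMod Λ)} (hC : IsTorsionClass K Λ C) (hle : C ⊆ T) (hne : ¬ T ⊆ C) :
    ∃ (B : Type u) (_ : AddCommGroup B) (_ : Module Λᵐᵒᵖ B), DD T B ∧ PP C B := by
  have hlt : (⟨C, hC⟩ : TorsionClass K Λ) < ⟨T, hT⟩ := lt_of_le_not_ge hle hne
  obtain ⟨E, hE, hcov⟩ := exists_le_covBy_of_lt (α := TorsionClass K Λ) hlt
  obtain ⟨B, i1, i2, hB, hP⟩ := cover_label hT E.2 hcov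
  exact ⟨B, i1, i2, hB, fun X _ _ hX f => hP X (hE hX) f⟩

/-- If a torsion class contains `𝒟(T)` then it contains `T`. -/
theorem sub_of_D {C : Set (RMod Λ)} (hC : IsTorsionClass K Λ C) (hD : DSet Λ T ⊆ C) : T ⊆ C := by
  by_contra hne
  have hI : IsTorsionClass K Λ (T ∩ C) :=
    ⟨fun M N e h => ⟨hT.iso_closed M N e h.1, hC.iso_closed M N e h.2⟩,
      fun M h => hT.finDim M h.1, fun M h => ⟨hT.zero_mem M h, hC.zero_mem M h⟩,
      fun M N f hf h => ⟨hT.quot_closed M N f hf h.1, hC.quot_closed M N f hf h.2⟩,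
      fun M A h1 h2 => ⟨hT.ext_closed M A h1.1 h2.1, hC.ext_closed M A h1.2 h2.2⟩⟩
  obtain ⟨B, _, _, hB, hP⟩ := lt_label hT hI Set.inter_subset_left
    (fun h => hne (h.trans Set.inter_subset_right))
  obtain ⟨b, hb⟩ := hB.2.1
  exact hb (LinearMap.congr_fun (hP B ⟨hB.1.1, hD ((mem_DSet_iff T (ModuleCat.of Λᵐᵒᵖ B)).2 hB)⟩
    LinearMap.id) b)

/-- Every nonzero module of `T` receives a nonzero map from `𝒟(T)`. -/
theorem exists_map_from_D {M : Type u} [AddCommGroup M] [Module Λᵐᵒᵖ M] (hM : In T M)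
    (hM0 : ∃ m : M, m ≠ 0) :
    ∃ (B : Type u) (_ : AddCommGroup B) (_ : Module Λᵐᵒᵖ B), DD T B ∧
      ∃ f : B →ₗ[Λᵐᵒᵖ] M, f ≠ 0 := by
  by_contra hcon
  push Not at hcon
  let S : Set (RMod Λ) := {Y | ∀ B ∈ DSet Λ T, ∀ f : B →ₗ[Λᵐᵒᵖ] Y, f = 0}
  have h1 : T ⊆ restr T S := sub_of_D hT (restr_tors hT S)
    (fun B hB => ⟨((mem_DSet_iff T B).1 hB).1.1, fun Y hY f => hY B hB f⟩)
  have h2 := (h1 hM).2 (ModuleCat.of Λᵐᵒᵖ M)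
    (fun B hB f => hcon B inferInstance inferInstance ((mem_DSet_iff T B).1 hB) f) LinearMap.id
  obtain ⟨m, hm⟩ := hM0
  exact hm (LinearMap.congr_fun h2 m)

/-- The pop-stack operator is orthogonality to `𝒟(T)`. -/
theorem isPopDown_iff (P : TorsionClass K Λ) :
    IsPopDown (⟨T, hT⟩ : TorsionClass K Λ) P ↔ P.1 = restr T (DSet Λ T) := by
  let Q : TorsionClass K Λ := ⟨restr T (DSet Λ T), restr_tors hT _⟩
  have hQ : IsGLB (insert (⟨T, hT⟩ : TorsionClass K Λ) {z | z ⋖ ⟨T, hT⟩}) Q := by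
    constructor
    · rintro C (rfl | hC)
      · exact fun X hX => hX.1
      · obtain ⟨B, _, _, hB, hP⟩ := cover_label hT C.2 hC
        let R : TorsionClass K Λ := ⟨restr T {ModuleCat.of Λᵐᵒᵖ B}, restr_tors hT _⟩
        have h1 : C ≤ R := by
          intro X hX
          refine ⟨hC.1.le hX, ?_⟩
          rintro Y rfl f
          exact hP X hX f
        have h2 : R ≤ ⟨T, hT⟩ := fun X hX => hX.1
        have h3 : ¬ (⟨T, hT⟩ : TorsionClass K Λ) ≤ R := by
          intro h
          obtain ⟨b, hb⟩ := hB.2.1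
          have h4 : ModuleCat.of Λᵐᵒᵖ B ∈ restr T {ModuleCat.of Λᵐᵒᵖ B} := h hB.1.1
          exact hb (LinearMap.congr_fun (h4.2 _ rfl LinearMap.id) b)
        have h5 : R ≤ C := by
          by_contra h
          exact hC.2 (lt_of_le_not_ge h1 h) (lt_of_le_not_ge h2 h3)
        refine le_trans ?_ h5
        intro X hX
        refine ⟨hX.1, ?_⟩
        rintro Y rfl f
        exact hX.2 _ ((mem_DSet_iff T (ModuleCat.of Λᵐᵒᵖ B)).2 hB) f
    · intro E hE X hX
      refine ⟨(hE (Set.mem_insert _ _) : E ≤ ⟨T, hT⟩) hX, fun B hB f => ?_⟩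
      have hB' := (mem_DSet_iff T B).1 hB
      let R : TorsionClass K Λ := ⟨restr T {B}, restr_tors hT _⟩
      have h2 : R ≤ ⟨T, hT⟩ := fun X hX => hX.1
      have h3 : ¬ (⟨T, hT⟩ : TorsionClass K Λ) ≤ R := by
        intro h
        obtain ⟨b, hb⟩ := hB'.2.1
        have h4 : B ∈ restr T {B} := h hB'.1.1
        exact hb (LinearMap.congr_fun (h4.2 _ rfl LinearMap.id) b)
      have hcov : R ⋖ ⟨T, hT⟩ := by
        refine ⟨lt_of_le_not_ge h2 h3, fun C hRC hCT => ?_⟩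
        obtain ⟨B', _, _, hBB, hP⟩ := lt_label hT C.2 hCT.le hCT.not_ge
        have h6 : ¬ In C.1 B' := by
          intro h
          obtain ⟨b, hb⟩ := hBB.2.1
          exact hb (LinearMap.congr_fun (hP B' h LinearMap.id) b)
        have h7 : ∃ g : B' →ₗ[Λᵐᵒᵖ] B, g ≠ 0 := by
          by_contra hcon
          push Not at hcon
          refine h6 (hRC.le (show ModuleCat.of Λᵐᵒᵖ B' ∈ restr T {B} from ⟨hBB.1.1, ?_⟩))
          rintro Y rfl g
          exact hcon g
        obtain ⟨g, hg⟩ := h7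
        let e := LinearEquiv.ofBijective g (DD_iso hT hBB hB' g hg)
        apply hRC.not_ge
        intro Y hY
        refine ⟨hCT.le hY, ?_⟩
        rintro _ rfl k
        have h8 := hP Y hY (e.symm.toLinearMap ∘ₗ k)
        ext y
        have := LinearMap.congr_fun h8 y
        simpa using this
      exact ((hE (Set.mem_insert_of_mem _ hcov)) hX).2 B rfl f
  constructor
  · intro h
    exact congrArg Subtype.val (h.unique hQ)
  · intro h
    have : P = Q := Subtype.ext h
    rw [this]
    exact hQ

/-- A nonzero module of `W_L(T)` has a nonzero map to some module of `𝒟(T)`. -/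
theorem WL_zero_of_restr {M : Type u} [AddCommGroup M] [Module Λᵐᵒᵖ M] (hM : WL T M)
    (hP : In (restr T (DSet Λ T)) M) : ∀ m : M, m = 0 := by
  by_contra hne
  have := (In_fin hT hM.1).1
  have hbt : (⊥ : Submodule Λᵐᵒᵖ M) ≠ ⊤ := by
    intro h
    apply hne
    intro m
    have : m ∈ (⊤ : Submodule Λᵐᵒᵖ M) := trivial
    rw [← h] at this
    simpa using this
  obtain ⟨L, ⟨hL, hL1⟩, hmax⟩ := set_has_maximal_iff_noetherian.2
    (inferInstance : IsNoetherian Λᵐᵒᵖ M)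
    {L : Submodule Λᵐᵒᵖ M | In T L ∧ L ≠ ⊤} ⟨⊥, In_bot hT, hbt⟩
  have hex : ∃ x, L.mkQ x ≠ 0 := by
    by_contra hcon
    push Not at hcon
    apply hL1
    rw [eq_top_iff]
    intro x _
    simpa using hcon x
  have hDD : DD T (M ⧸ L) := by
    refine ⟨WL_quot hT hM L hL, ?_, fun U hU => ?_⟩
    · obtain ⟨x, hx⟩ := hex
      exact ⟨_, hx⟩
    · have h1 := In_comap hT L hL U hU
      have hle : L ≤ U.comap L.mkQ := by
        intro x hx
        have : L.mkQ x = 0 := by simpa using hx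
        simp [Submodule.mem_comap, this]
      by_cases h2 : U.comap L.mkQ = ⊤
      · right
        rw [eq_top_iff]
        intro y _
        obtain ⟨x, rfl⟩ := L.mkQ_surjective y
        have : x ∈ U.comap L.mkQ := by rw [h2]; trivial
        exact this
      · left
        have h3 : U.comap L.mkQ = L := ((hle.lt_or_eq).resolve_left (hmax _ ⟨h1, h2⟩)).symm
        rw [eq_bot_iff]
        intro y hy
        obtain ⟨x, rfl⟩ := L.mkQ_surjective y
        have : x ∈ U.comap L.mkQ := hy
        rw [h3] at this
        simpa using this
  obtain ⟨x, hx⟩ := hex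
  exact hx (LinearMap.congr_fun (hP.2 (ModuleCat.of Λᵐᵒᵖ (M ⧸ L))
    ((mem_DSet_iff T (ModuleCat.of Λᵐᵒᵖ (M ⧸ L))).2 hDD) L.mkQ) x)

end Tors

/-- One step of a filtration. -/
def Step (𝒞 : Set (RMod Λ)) (M : Type u) [AddCommGroup M] [Module Λᵐᵒᵖ M]
    (A B : Submodule Λᵐᵒᵖ M) : Prop :=
  A ≤ B ∧ ∃ C ∈ 𝒞, Nonempty ((↥B ⧸ Submodule.comap B.subtype A) ≃ₗ[Λᵐᵒᵖ] C)

theorem Filt_iff (𝒞 : Set (RMod Λ)) (M : RMod Λ) :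
    M ∈ FiltSet Λ 𝒞 ↔ Relation.ReflTransGen (Step 𝒞 M) ⊥ ⊤ := by
  constructor
  · rintro ⟨r, c, hmono, h0, h1, hstep⟩
    have : ∀ i : Fin (r + 1), Relation.ReflTransGen (Step 𝒞 M) ⊥ (c i) := by
      intro i
      induction i using Fin.induction with
      | zero => rw [h0]
      | succ i ih =>
        exact ih.tail ⟨hmono (Fin.castSucc_le_succ i), hstep i⟩
    rw [← h1]
    exact this _
  · intro h
    have key : ∀ A, Relation.ReflTransGen (Step 𝒞 M) ⊥ A →
        ∃ (r : ℕ) (c : Fin (r + 1) → Submodule Λᵐᵒᵖ M), c 0 = ⊥ ∧ c (Fin.last r) = A ∧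
          ∀ i : Fin r, Step 𝒞 M (c i.castSucc) (c i.succ) := by
      intro A hA
      induction hA with
      | refl => exact ⟨0, fun _ => ⊥, rfl, rfl, fun i => i.elim0⟩
      | @tail A B hA hAB ih =>
        obtain ⟨r, c, h0, h1, hs⟩ := ih
        refine ⟨r + 1, Fin.snoc (α := fun _ => Submodule Λᵐᵒᵖ M) c B, ?_, ?_, ?_⟩
        · have : (0 : Fin (r + 1 + 1)) = Fin.castSucc 0 := rfl
          rw [this, Fin.snoc_castSucc, h0]
        · rw [Fin.snoc_last]
        · intro i
          induction i using Fin.lastCases with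
          | last =>
            rw [Fin.snoc_castSucc, Fin.succ_last, Fin.snoc_last, h1]
            exact hAB
          | cast i =>
            rw [Fin.snoc_castSucc, Fin.succ_castSucc, Fin.snoc_castSucc]
            exact hs i
    obtain ⟨r, c, h0, h1, hs⟩ := key ⊤ h
    exact ⟨r, c, Fin.monotone_iff_le_succ.2 fun i => (hs i).1, h0, h1, fun i => (hs i).2⟩

theorem Filt_sub {T : Set (RMod Λ)} (hT : IsTorsionClass K Λ T) {𝒞 : Set (RMod Λ)} (h : 𝒞 ⊆ T) :
    FiltSet Λ 𝒞 ⊆ T := by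
  intro M hM
  rw [Filt_iff] at hM
  have key : ∀ A, Relation.ReflTransGen (Step 𝒞 M) ⊥ A → In T A := by
    intro A hA
    induction hA with
    | refl => exact In_bot hT
    | @tail A B hA hAB ih =>
      obtain ⟨hle, C, hC, ⟨e⟩⟩ := hAB
      refine In_ext hT (Submodule.comap B.subtype A) ?_ ?_
      · exact In_equiv hT ih (Submodule.comapSubtypeEquivOfLe hle).symm
      · exact In_equiv hT (show In T C from h hC) e.symm
  exact In_equiv hT (key ⊤ hM) Submodule.topEquiv

section Key

variable {T : Set (RMod Λ)} (hT : IsTorsionClass K Λ T)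

include hT

/-- `T ∩ (pop↓ T)⊥` consists of `𝒟(T)`-filtered modules, which lie in `W_L(T)`. -/
theorem Filt_of_perp {M : Type u} [AddCommGroup M] [Module Λᵐᵒᵖ M] (hM : In T M)
    (hP : PP (restr T (DSet Λ T)) M) :
    ModuleCat.of Λᵐᵒᵖ M ∈ FiltSet Λ (DSet Λ T) ∧ WL T M := by
  have := (In_fin hT hM).2
  have key : ∀ A : Submodule Λᵐᵒᵖ M, In T A →
      Relation.ReflTransGen (Step (DSet Λ T) M) ⊥ A ∧ WL T A := by
    intro A
    induction A using WellFoundedLT.induction with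
    | ind A ih =>
      intro hA
      by_cases hA0 : A = ⊥
      · subst hA0
        refine ⟨Relation.ReflTransGen.refl, hA, fun N _ _ hN f => ?_⟩
        have : f = 0 := by
          ext x
        rw [this, LinearMap.ker_zero]
        exact In_top hT hN
      have hPA : PP (restr T (DSet Λ T)) A := PP_inj hP A.subtype A.subtype_injective
      have hnot : ¬ In (restr T (DSet Λ T)) A := by
        intro h
        apply hA0
        rw [eq_bot_iff]
        intro x hx
        have := congrArg Subtype.val (LinearMap.congr_fun (hPA A h LinearMap.id) ⟨x, hx⟩)
        simpa using this
      have hex : ∃ B ∈ DSet Λ T, ∃ f : A →ₗ[Λᵐᵒᵖ] B, f ≠ 0 := by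
        by_contra hcon
        push Not at hcon
        exact hnot ⟨hA, hcon⟩
      obtain ⟨B, hB, f, hf⟩ := hex
      have hB' := (mem_DSet_iff T B).1 hB
      have hfr : LinearMap.range f = ⊤ :=
        (hB'.2.2 _ (In_range hT hA f)).resolve_left fun h => hf (LinearMap.range_eq_bot.1 h)
      let L : Submodule Λᵐᵒᵖ M := (LinearMap.ker f).map A.subtype
      have hker : In T (LinearMap.ker f) := hB'.1.2 A hA f
      have hL : In T L := In_equiv hT hker
        (Submodule.equivMapOfInjective _ A.subtype_injective _)
      have hLA : L ≤ A := Submodule.map_subtype_le _ _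
      have hcL : Submodule.comap A.subtype L = LinearMap.ker f :=
        Submodule.comap_map_eq_of_injective A.subtype_injective _
      have hLA' : L < A := by
        refine lt_of_le_of_ne hLA fun h => hf ?_
        rw [← LinearMap.ker_eq_top, ← hcL, h]
        simp
      obtain ⟨h1, h2⟩ := ih L hLA' hL
      let e : (↥A ⧸ Submodule.comap A.subtype L) ≃ₗ[Λᵐᵒᵖ] B :=
        (Submodule.quotEquivOfEq _ _ hcL).trans
          (f.quotKerEquivOfSurjective (LinearMap.range_eq_top.1 hfr))
      refine ⟨h1.tail ⟨hLA, B, hB, ⟨e⟩⟩, ?_⟩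
      refine WL_ext hT (Submodule.comap A.subtype L) ?_ ?_
      · exact WL_equiv hT h2 (Submodule.comapSubtypeEquivOfLe hLA).symm
      · exact WL_equiv hT hB'.1 e.symm
  obtain ⟨h1, h2⟩ := key ⊤ (In_top hT hM)
  exact ⟨(Filt_iff _ (ModuleCat.of Λᵐᵒᵖ M)).2 h1, WL_equiv hT h2 Submodule.topEquiv⟩

end Key

/-! ### WU -/

section Upper

variable {T : Set (RMod Λ)}
variable {B : Type u} [AddCommGroup B] [Module Λᵐᵒᵖ B]

theorem WU_ker (hB : WU T B) (L : Submodule Λᵐᵒᵖ B) (hL : PP T (B ⧸ L)) : WU T L := by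
  refine ⟨PP_inj hB.1 L.subtype L.subtype_injective, fun A _ _ hA f => ?_⟩
  let U : Submodule Λᵐᵒᵖ (A × B) := LinearMap.range (f.prod (-L.subtype))
  have hU : ∀ a b, (a, b) ∈ U ↔ ∃ l : L, f l = a ∧ -(l : B) = b := by
    intro a b
    simp [U, Prod.ext_iff]
  let p : ((A × B) ⧸ U) →ₗ[Λᵐᵒᵖ] (B ⧸ L) := U.liftQ (L.mkQ ∘ₗ LinearMap.snd Λᵐᵒᵖ A B) (by
    rintro ⟨a, b⟩ hx
    obtain ⟨l, -, rfl⟩ := (hU a b).1 hx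
    simp)
  let iA : A →ₗ[Λᵐᵒᵖ] ((A × B) ⧸ U) := U.mkQ ∘ₗ LinearMap.inl Λᵐᵒᵖ A B
  let iB : B →ₗ[Λᵐᵒᵖ] ((A × B) ⧸ U) := U.mkQ ∘ₗ LinearMap.inr Λᵐᵒᵖ A B
  have hiA : Function.Injective iA := by
    rw [← LinearMap.ker_eq_bot, LinearMap.ker_eq_bot']
    intro a ha
    have : (a, (0 : B)) ∈ U := by simpa [iA] using ha
    obtain ⟨l, h1, h2⟩ := (hU _ _).1 this
    have : l = 0 := by
      ext
      simpa using h2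
    rw [← h1, this, map_zero]
  have hle : LinearMap.ker p ≤ LinearMap.range iA := by
    intro y hy
    obtain ⟨⟨a, b⟩, rfl⟩ := U.mkQ_surjective y
    have hb : b ∈ L := by simpa [p] using hy
    refine ⟨a + f ⟨b, hb⟩, ?_⟩
    rw [← sub_eq_zero]
    have : ((f ⟨b, hb⟩, -b) : A × B) ∈ U := (hU _ _).2 ⟨⟨b, hb⟩, rfl, rfl⟩
    have h2 : iA (a + f ⟨b, hb⟩) - U.mkQ (a, b) = U.mkQ (f ⟨b, hb⟩, -b) := by
      simp only [iA, LinearMap.comp_apply, ← map_sub]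
      simp
    rw [h2]
    simpa using this
  have hQ : PP T ((A × B) ⧸ U) := by
    refine PP_ext p ?_ hL
    let e := LinearEquiv.ofInjective iA hiA
    exact PP_inj hA (e.symm.toLinearMap ∘ₗ Submodule.inclusion hle)
      (e.symm.injective.comp (Submodule.inclusion_injective hle))
  have hQ' := hB.2 _ hQ iB
  let k : (A ⧸ LinearMap.range f) →ₗ[Λᵐᵒᵖ] (((A × B) ⧸ U) ⧸ LinearMap.range iB) :=
    (LinearMap.range f).mapQ (LinearMap.range iB) iA (by
      rintro _ ⟨l, rfl⟩
      refine ⟨(l : B), ?_⟩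
      rw [eq_comm, ← sub_eq_zero]
      have : ((f l, -(l : B)) : A × B) ∈ U := (hU _ _).2 ⟨l, rfl, rfl⟩
      have h2 : iA (f l) - iB (l : B) = U.mkQ (f l, -(l : B)) := by
        simp only [iA, iB, LinearMap.comp_apply, ← map_sub]
        simp
      rw [h2]
      simpa using this)
  refine PP_inj hQ' k ?_
  rw [← LinearMap.ker_eq_bot, LinearMap.ker_eq_bot']
  intro y hy
  obtain ⟨a, rfl⟩ := (LinearMap.range f).mkQ_surjective y
  have : iA a ∈ LinearMap.range iB := by simpa [k] using hy
  obtain ⟨b, hb⟩ := this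
  have h3 : ((a, -b) : A × B) ∈ U := by
    have h4 : U.mkQ (a, -b) = 0 := by
      have : ((a, -b) : A × B) = LinearMap.inl Λᵐᵒᵖ A B a - LinearMap.inr Λᵐᵒᵖ A B b := by simp
      rw [this, map_sub, sub_eq_zero]
      exact hb.symm
    simpa using h4
  obtain ⟨l, h1, -⟩ := (hU _ _).1 h3
  have : a ∈ LinearMap.range f := ⟨l, h1⟩
  simpa using this

end Upper

end Helpers

/-- Let `Λ` be a τ-tilting finite finite-dimensional `K`-algebra and let
`𝒯, 𝒯′` be torsion classes.  Then `pop↓(𝒯′) = 𝒯` in `tors Λ` if and only if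
(1) every module in `𝒟(𝒯′)` is isomorphic to a module in `𝒰(𝒯)`, and
(2) every `X ∈ 𝒟(𝒯)` admits a surjection from some module of `Filt(𝒟(𝒯′))`. -/
theorem stmt0 [FiniteDimensional K Λ] (hfin : Finite (TorsionClass K Λ))
    (T' T : TorsionClass K Λ) :
    IsPopDown T' T ↔
      ((∀ M ∈ DSet Λ T'.1, ∃ N ∈ USet Λ T.1, Nonempty (M ≃ₗ[Λᵐᵒᵖ] N)) ∧
        (∀ X ∈ DSet Λ T.1, ∃ Z ∈ FiltSet Λ (DSet Λ T'.1),
          ∃ f : Z →ₗ[Λᵐᵒᵖ] X, Function.Surjective f)) := by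
  have := hfin
  obtain ⟨T', hT'⟩ := T'
  obtain ⟨T, hT⟩ := T
  refine (isPopDown_iff hT' ⟨T, hT⟩).trans ?_
  change T = restr T' (DSet Λ T') ↔
      ((∀ M ∈ DSet Λ T', ∃ N ∈ USet Λ T, Nonempty (M ≃ₗ[Λᵐᵒᵖ] N)) ∧
        (∀ X ∈ DSet Λ T, ∃ Z ∈ FiltSet Λ (DSet Λ T'),
          ∃ f : Z →ₗ[Λᵐᵒᵖ] X, Function.Surjective f))
  constructor
  · intro hTeq
    have hTT : T ⊆ T' := by rw [hTeq]; exact fun X hX => hX.1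
    have hDP : ∀ M ∈ DSet Λ T', PP T M := by
      intro M hM X _ _ hX f
      rw [hTeq] at hX
      exact hX.2 M hM f
    constructor
    · intro M hM
      refine ⟨M, ?_, ⟨LinearEquiv.refl _ _⟩⟩
      have hM' := (mem_DSet_iff T' M).1 hM
      have hWU : WU T M := by
        refine ⟨hDP M hM, fun N _ _ hN f X _ _ hX g => ?_⟩
        let N' : Submodule Λᵐᵒᵖ N := (LinearMap.range g).comap (LinearMap.range f).mkQ
        have hle : LinearMap.range f ≤ N' := by
          intro x hx
          have : (LinearMap.range f).mkQ x = 0 := by simpa using hx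
          simp [N', Submodule.mem_comap, -LinearMap.mem_range, this]
        have hN'T : In T' N' := In_comap hT' _ (In_range hT' hM'.1.1 f) _
          (hTT (In_range hT hX g))
        have hN'P : PP T N' := PP_inj hN N'.subtype N'.subtype_injective
        have hN'W : WL T' N' := (Filt_of_perp hT' hN'T (by rw [← hTeq]; exact hN'P)).2
        let h : N' →ₗ[Λᵐᵒᵖ] (N ⧸ LinearMap.range f) := (LinearMap.range f).mkQ ∘ₗ N'.subtype
        have hker : LinearMap.ker h = (LinearMap.range f).comap N'.subtype := by
          rw [LinearMap.ker_comp, Submodule.ker_mkQ]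
        have hrange : LinearMap.range h = LinearMap.range g := by
          rw [LinearMap.range_comp, Submodule.range_subtype, Submodule.map_comap_eq,
            Submodule.range_mkQ, top_inf_eq]
        have hkT : In T' (LinearMap.ker h) := by
          rw [hker]
          exact In_equiv hT' (In_range hT' hM'.1.1 f) (Submodule.comapSubtypeEquivOfLe hle).symm
        have hW : WL T' (LinearMap.range h) :=
          WL_equiv hT' (WL_quot hT' hN'W _ hkT) h.quotKerEquivRange
        rw [hrange] at hW
        have hz := WL_zero_of_restr hT' hW (by rw [← hTeq]; exact In_range hT hX g)
        ext x
        exact congrArg Subtype.val (hz ⟨g x, x, rfl⟩)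
      refine ⟨(mem_WUpper_iff T M).2 hWU, hM'.2.1, fun N hN => ?_⟩
      have hN' : WU T N := (mem_WUpper_iff T _).1 hN
      have h1 := hN'.2 M hWU.1 N.subtype
      rw [Submodule.range_subtype] at h1
      have h2 : WL T' (M ⧸ N) :=
        (Filt_of_perp hT' (In_quot hT' hM'.1.1 N) (by rw [← hTeq]; exact h1)).2
      have h3 := h2.2 M hM'.1.1 N.mkQ
      rw [Submodule.ker_mkQ] at h3
      exact hM'.2.2 N h3
    · intro X hX
      have hX' := (mem_DSet_iff T X).1 hX
      have hXT' : In T' X := hTT hX'.1.1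
      have := (In_fin hT' hXT').1
      have hbt : (⊥ : Submodule Λᵐᵒᵖ X) ≠ ⊤ := by
        intro h
        obtain ⟨m, hm⟩ := hX'.2.1
        have : m ∈ (⊤ : Submodule Λᵐᵒᵖ X) := trivial
        rw [← h] at this
        exact hm (by simpa using this)
      obtain ⟨Y, ⟨hY, hY1⟩, hmax⟩ := set_has_maximal_iff_noetherian.2
        (inferInstance : IsNoetherian Λᵐᵒᵖ X)
        {L : Submodule Λᵐᵒᵖ X | In T' L ∧ L ≠ ⊤} ⟨⊥, In_bot hT', hbt⟩
      have hYP : PP T Y := by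
        intro A _ _ hA g
        let g' : A →ₗ[Λᵐᵒᵖ] X := Y.subtype ∘ₗ g
        rcases hX'.2.2 _ (In_range hT hA g') with h | h
        · ext a
          have := LinearMap.congr_fun (LinearMap.range_eq_bot.1 h) a
          simpa [g'] using this
        · exfalso
          apply hY1
          rw [eq_top_iff, ← h]
          rintro _ ⟨a, rfl⟩
          exact (g a).2
      have hex : ∃ x, Y.mkQ x ≠ 0 := by
        by_contra hcon
        push Not at hcon
        apply hY1
        rw [eq_top_iff]
        intro x _
        simpa using hcon x
      obtain ⟨B, _, _, hB, f, hf⟩ := exists_map_from_D hT' (In_quot hT' hXT' Y)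
        (by obtain ⟨x, hx⟩ := hex; exact ⟨_, hx⟩)
      have hBP : PP T B := hDP (ModuleCat.of Λᵐᵒᵖ B) ((mem_DSet_iff T' (ModuleCat.of Λᵐᵒᵖ B)).2 hB)
      -- the pullback
      let d : (B × X) →ₗ[Λᵐᵒᵖ] (X ⧸ Y) :=
        f ∘ₗ LinearMap.fst Λᵐᵒᵖ B X - Y.mkQ ∘ₗ LinearMap.snd Λᵐᵒᵖ B X
      have hd : ∀ x, x ∈ LinearMap.ker d ↔ f x.1 = Y.mkQ x.2 := by
        intro x
        simp [d, sub_eq_zero]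
      let p : LinearMap.ker d →ₗ[Λᵐᵒᵖ] B := LinearMap.fst Λᵐᵒᵖ B X ∘ₗ (LinearMap.ker d).subtype
      let q : LinearMap.ker d →ₗ[Λᵐᵒᵖ] X := LinearMap.snd Λᵐᵒᵖ B X ∘ₗ (LinearMap.ker d).subtype
      let k : Y →ₗ[Λᵐᵒᵖ] LinearMap.ker p := LinearMap.codRestrict _
        (LinearMap.codRestrict (LinearMap.ker d) (LinearMap.inr Λᵐᵒᵖ B X ∘ₗ Y.subtype) (by
          intro x; rw [hd]; simp [eq_comm (a := (0 : _ ⧸ _))])) (by intro x; simp [p])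
      have hk : Function.Bijective k := by
        constructor
        · intro y y' h
          have h1 : q (k y).1 = q (k y').1 := by rw [h]
          exact Subtype.ext h1
        · rintro ⟨⟨⟨a, m⟩, hx⟩, hy⟩
          have ha : a = 0 := by simpa [p] using hy
          have hm : m ∈ Y := by
            have := (hd _).1 hx
            rw [ha, map_zero] at this
            simpa using this.symm
          refine ⟨⟨m, hm⟩, ?_⟩
          subst ha
          rfl
      let e := LinearEquiv.ofBijective k hk
      have hpr : LinearMap.range p = ⊤ := by
        rw [LinearMap.range_eq_top]
        intro a
        obtain ⟨m, hm⟩ := Y.mkQ_surjective (f a)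
        exact ⟨⟨(a, m), (hd _).2 hm.symm⟩, rfl⟩
      have hET : In T' (LinearMap.ker d) := by
        refine In_ext' hT' p (In_equiv hT' hY e) ?_
        rw [hpr]
        exact In_top hT' hB.1.1
      have hEP : PP T (LinearMap.ker d) :=
        PP_ext p (PP_inj hYP e.symm.toLinearMap e.symm.injective) hBP
      refine ⟨ModuleCat.of Λᵐᵒᵖ (LinearMap.ker d),
        (Filt_of_perp hT' hET (by rw [← hTeq]; exact hEP)).1, q, ?_⟩
      rw [← LinearMap.range_eq_top]
      by_contra hne
      refine hmax _ ⟨In_range hT' hET q, hne⟩ ?_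
      refine lt_of_le_of_ne ?_ ?_
      · intro y hy
        exact ⟨(k ⟨y, hy⟩).1, rfl⟩
      · intro heq
        apply hf
        ext b
        obtain ⟨m, hm⟩ := Y.mkQ_surjective (f b)
        have h1 : m ∈ LinearMap.range q := ⟨⟨(b, m), (hd _).2 hm.symm⟩, rfl⟩
        rw [← heq] at h1
        rw [← hm]
        simpa using h1
  · rintro ⟨h1, h2⟩
    have hTT : T ⊆ T' := by
      refine sub_of_D hT hT' fun X hX => ?_
      obtain ⟨Z, hZ, f, hf⟩ := h2 X hX
      have hZT : Z ∈ T' :=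
        Filt_sub hT' (fun B hB => ((mem_DSet_iff T' B).1 hB).1.1) hZ
      exact hT'.quot_closed Z X f hf hZT
    refine Set.Subset.antisymm ?_ ?_
    · intro X hX
      refine ⟨hTT hX, fun B hB f => ?_⟩
      obtain ⟨N, hN, ⟨e⟩⟩ := h1 B hB
      have hNP : PP T N := ((mem_WUpper_iff T N).1 hN.1).1
      exact (PP_inj hNP e.toLinearMap e.injective) X hX f
    · intro M hM
      have hPt := restr_tors hT' (DSet Λ T')
      have hMP : In (restr T' (DSet Λ T')) M := hM
      have hMT' : In T' M := hM.1
      have := (In_fin hT' hMT').1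
      have key : ∀ L : Submodule Λᵐᵒᵖ M, PP T (M ⧸ L) → L = ⊤ := by
        intro L
        induction L using WellFoundedGT.induction with
        | ind L ih =>
          intro hL
          by_contra hLt
          have hex : ∃ x, L.mkQ x ≠ 0 := by
            by_contra hcon
            push Not at hcon
            apply hLt
            rw [eq_top_iff]
            intro x _
            simpa using hcon x
          have hQP : In (restr T' (DSet Λ T')) (M ⧸ L) := In_quot hPt hMP L
          obtain ⟨B, _, _, hB, f, hf⟩ := exists_map_from_D hT' (In_quot hT' hMT' L)
            (by obtain ⟨x, hx⟩ := hex; exact ⟨_, hx⟩)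
          have hBmem : ModuleCat.of Λᵐᵒᵖ B ∈ DSet Λ T' :=
            (mem_DSet_iff T' (ModuleCat.of Λᵐᵒᵖ B)).2 hB
          obtain ⟨N, hN, ⟨e⟩⟩ := h1 _ hBmem
          have hNW := (mem_WUpper_iff T N).1 hN.1
          let g : N →ₗ[Λᵐᵒᵖ] (M ⧸ L) := f ∘ₗ e.symm.toLinearMap
          have hg : g ≠ 0 := by
            intro h
            apply hf
            ext b
            have := LinearMap.congr_fun h (e b)
            simpa [g] using this
          have hc := hNW.2 _ hL g
          have hlt : L < (LinearMap.range g).comap L.mkQ := by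
            refine lt_of_le_of_ne ?_ ?_
            · intro x hx
              have : L.mkQ x = 0 := by simpa using hx
              simp [Submodule.mem_comap, -LinearMap.mem_range, this]
            · intro heq
              apply hg
              ext n
              obtain ⟨m, hm⟩ := L.mkQ_surjective (g n)
              have h3 : m ∈ (LinearMap.range g).comap L.mkQ := by
                rw [Submodule.mem_comap, hm]; exact ⟨n, rfl⟩
              rw [← heq] at h3
              rw [← hm]
              simpa using h3
          have htop := ih _ hlt (by
            refine PP_inj hc (Submodule.mapQ _ _ L.mkQ le_rfl) ?_
            rw [← LinearMap.ker_eq_bot, LinearMap.ker_eq_bot']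
            intro y hy
            obtain ⟨m, rfl⟩ := Submodule.mkQ_surjective _ y
            simpa using hy)
          have hgs : Function.Surjective g := by
            intro y
            obtain ⟨m, rfl⟩ := L.mkQ_surjective y
            have : m ∈ (LinearMap.range g).comap L.mkQ := by rw [htop]; trivial
            exact this
          let eq := g.quotKerEquivOfSurjective hgs
          have hkW : WU T (LinearMap.ker g) :=
            WU_ker hNW _ (PP_inj hL eq.toLinearMap eq.injective)
          rcases hN.2.2 (LinearMap.ker g) ((mem_WUpper_iff T _).2 hkW) with h | h
          · let eg := LinearEquiv.ofBijective g ⟨LinearMap.ker_eq_bot.1 h, hgs⟩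
            have h0 := hQP.2 _ hBmem (e.symm.toLinearMap ∘ₗ eg.symm.toLinearMap)
            obtain ⟨b, hb⟩ := hB.2.1
            apply hb
            have := LinearMap.congr_fun h0 (eg (e b))
            simpa using this
          · exact hg (LinearMap.ker_eq_top.1 h)
      obtain ⟨L, hL, hPL⟩ := exists_torsion_sub hT (M := M)
      have := key L hPL
      subst this
      exact In_equiv hT hL Submodule.topEquiv

end PaperTors
end

section
/- Let K be a field, Λ a τ-tilting finite finite-dimensional K-algebra, and 𝒯 a torsion class of finite-dimensional right Λ-modules. The following are equivalent: (1) there exists a torsion class 𝒯′ with pop↓(𝒯′) = 𝒯 (i.e., 𝒯 lies in the image of the pop-stack operator of tors Λ); (2) pop↓(pop↑(𝒯)) = 𝒯; (3) for every X ∈ 𝒟(𝒯), there exists a module Z ∈ Filt(𝒰(𝒯)) admitting a surjective Λ-module homomorphism Z ↠ X. -/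
namespace PaperTors

universe u

variable (K : Type u) [Field K] (Λ : Type u) [Ring Λ] [Algebra K Λ]

variable {K}

section Helpers

variable {Λ}

theorem perp_inj {𝒯 : Set (RMod Λ)} {M N : RMod Λ} (hN : N ∈ Perp Λ 𝒯)
    (f : M →ₗ[Λᵐᵒᵖ] N) (hf : Function.Injective f) : M ∈ Perp Λ 𝒯 := by
  intro T hT g
  have h := hN T hT (f ∘ₗ g)
  ext x
  apply hf
  simpa using LinearMap.congr_fun h x

theorem perp_sub {𝒯 : Set (RMod Λ)} {N : RMod Λ} (hN : N ∈ Perp Λ 𝒯)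
    (A : Submodule Λᵐᵒᵖ N) : ModuleCat.of Λᵐᵒᵖ A ∈ Perp Λ 𝒯 :=
  perp_inj (M := ModuleCat.of Λᵐᵒᵖ A) hN A.subtype A.injective_subtype

/-- extension of torsion-free modules, for a map `f : N → Q` whose kernel is the image of `i`. -/
theorem perp_ext {𝒯 : Set (RMod Λ)} {A N Q : RMod Λ} (hA : A ∈ Perp Λ 𝒯) (hQ : Q ∈ Perp Λ 𝒯)
    (f : N →ₗ[Λᵐᵒᵖ] Q) (i : LinearMap.ker f →ₗ[Λᵐᵒᵖ] A) (hi : Function.Injective i) :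
    N ∈ Perp Λ 𝒯 := by
  intro T hT g
  have h := hQ T hT (f ∘ₗ g)
  have hk : ∀ x, g x ∈ LinearMap.ker f := fun x => by
    simpa using LinearMap.congr_fun h x
  have h2 := hA T hT (i ∘ₗ g.codRestrict _ hk)
  ext x
  have h3 := LinearMap.congr_fun h2 x
  have h4 : g.codRestrict _ hk x = 0 := hi (by simpa using h3)
  simpa using congrArg Subtype.val h4

theorem perp_anti {𝒯 𝒯' : Set (RMod Λ)} (h : 𝒯 ⊆ 𝒯') : Perp Λ 𝒯' ⊆ Perp Λ 𝒯 :=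
  fun _ hM T hT f => hM T (h hT) f

theorem eq_zero_of_mem_perp {𝒯 : Set (RMod Λ)} {M : RMod Λ} (h : M ∈ 𝒯) (h' : M ∈ Perp Λ 𝒯)
    (m : M) : m = 0 := by
  simpa using LinearMap.congr_fun (h' M h LinearMap.id) m

theorem range_mem (T : TorsionClass K Λ) {M N : RMod Λ} (f : M →ₗ[Λᵐᵒᵖ] N) (hM : M ∈ T.1) :
    ModuleCat.of Λᵐᵒᵖ (LinearMap.range f) ∈ T.1 :=
  T.2.quot_closed M (ModuleCat.of Λᵐᵒᵖ (LinearMap.range f)) f.rangeRestrict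
    f.surjective_rangeRestrict hM

theorem ext_mem (T : TorsionClass K Λ) {A M N : RMod Λ} (i : A →ₗ[Λᵐᵒᵖ] M) (f : M →ₗ[Λᵐᵒᵖ] N)
    (hf : Function.Surjective f) (hif : LinearMap.range i = LinearMap.ker f)
    (hA : A ∈ T.1) (hN : N ∈ T.1) : M ∈ T.1 := by
  refine T.2.ext_closed M (LinearMap.ker f) ?_ ?_
  · rw [← hif]
    exact range_mem T i hA
  · exact T.2.iso_closed N _ (f.quotKerEquivOfSurjective hf).symm hN

theorem zero_of_ker_le (T : TorsionClass K Λ) {M N Y : RMod Λ}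
    (f : M →ₗ[Λᵐᵒᵖ] N) (hf : Function.Surjective f) (hN : N ∈ T.1) (hY : Y ∈ Perp Λ T.1)
    (π : M →ₗ[Λᵐᵒᵖ] Y) (hk : LinearMap.ker f ≤ LinearMap.ker π) : π = 0 := by
  have h1 : ModuleCat.of Λᵐᵒᵖ (M ⧸ LinearMap.ker f) ∈ T.1 :=
    T.2.iso_closed N (ModuleCat.of Λᵐᵒᵖ (M ⧸ LinearMap.ker f))
      (f.quotKerEquivOfSurjective hf).symm hN
  have h2 := hY _ h1 ((LinearMap.ker f).liftQ π hk)
  ext x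
  simpa using LinearMap.congr_fun h2 (Submodule.Quotient.mk x)

/-- finite-dimensional versus finitely generated -/
theorem isFinDim_iff [FiniteDimensional K Λ] (M : RMod Λ) :
    IsFinDim K Λ M ↔ Module.Finite Λᵐᵒᵖ M := by
  unfold IsFinDim
  let _ : Module K M := Module.compHom M (algebraMap K Λᵐᵒᵖ)
  have : IsScalarTower K Λᵐᵒᵖ M := IsScalarTower.of_algebraMap_smul fun _ _ => rfl
  have : Module.Finite K Λᵐᵒᵖ :=
    Module.Finite.equiv (MulOpposite.opLinearEquiv K : Λ ≃ₗ[K] Λᵐᵒᵖ)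
  constructor
  · intro h
    exact Module.Finite.of_restrictScalars_finite K Λᵐᵒᵖ M
  · intro h
    exact Module.Finite.trans Λᵐᵒᵖ M

theorem isArtinianRing_op [FiniteDimensional K Λ] : IsArtinianRing Λᵐᵒᵖ := by
  have : Module.Finite K Λᵐᵒᵖ :=
    Module.Finite.equiv (MulOpposite.opLinearEquiv K : Λ ≃ₗ[K] Λᵐᵒᵖ)
  exact IsArtinianRing.of_finite K Λᵐᵒᵖ

theorem finite_of_mem [FiniteDimensional K Λ] (T : TorsionClass K Λ) {M : RMod Λ} (h : M ∈ T.1) :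
    Module.Finite Λᵐᵒᵖ M := (isFinDim_iff (K := K) M).1 (T.2.finDim M h)

theorem artinian_of_mem [FiniteDimensional K Λ] (T : TorsionClass K Λ) {M : RMod Λ}
    (h : M ∈ T.1) : IsArtinian Λᵐᵒᵖ M := by
  have := finite_of_mem T h
  have : IsArtinianRing Λᵐᵒᵖ := isArtinianRing_op (K := K)
  infer_instance

theorem noetherian_of_mem [FiniteDimensional K Λ] (T : TorsionClass K Λ) {M : RMod Λ}
    (h : M ∈ T.1) : IsNoetherian Λᵐᵒᵖ M := by
  have := finite_of_mem T h
  have : IsArtinianRing Λᵐᵒᵖ := isArtinianRing_op (K := K)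
  infer_instance

variable (K Λ) in
/-- the torsion class of all finite-dimensional modules -/
def topT [FiniteDimensional K Λ] : TorsionClass K Λ :=
  ⟨{M | Module.Finite Λᵐᵒᵖ M},
    { iso_closed := fun M N e (h : Module.Finite Λᵐᵒᵖ M) => Module.Finite.equiv e
      finDim := fun M h => (isFinDim_iff M).2 h
      zero_mem := fun M h => (inferInstance : Module.Finite Λᵐᵒᵖ M)
      quot_closed := fun M N f hf (h : Module.Finite Λᵐᵒᵖ M) => Module.Finite.of_surjective f hf
      ext_closed := fun M A (hA : Module.Finite Λᵐᵒᵖ A) (hQ : Module.Finite Λᵐᵒᵖ (M ⧸ A)) =>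
        Module.Finite.of_submodule_quotient A }⟩

theorem le_topT [FiniteDimensional K Λ] (T : TorsionClass K Λ) : T ≤ topT K Λ :=
  fun _ h => finite_of_mem T h

/-- `T ∩ ⊥𝒥` -/
def leftPerp (T : TorsionClass K Λ) (𝒥 : Set (RMod Λ)) : TorsionClass K Λ :=
  ⟨{M | M ∈ T.1 ∧ ∀ I ∈ 𝒥, ∀ f : M →ₗ[Λᵐᵒᵖ] I, f = 0},
    { iso_closed := fun M N e h => ⟨T.2.iso_closed M N e h.1, fun I hI f => by
        have h2 := h.2 I hI (f ∘ₗ e.toLinearMap)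
        ext x
        simpa using LinearMap.congr_fun h2 (e.symm x)⟩
      finDim := fun M h => T.2.finDim M h.1
      zero_mem := fun M h => ⟨T.2.zero_mem M h, fun I hI f => by
        ext x
        rw [Subsingleton.elim x 0]
        simp⟩
      quot_closed := fun M N g hg h => ⟨T.2.quot_closed M N g hg h.1, fun I hI f => by
        have h2 := h.2 I hI (f ∘ₗ g)
        ext x
        obtain ⟨y, rfl⟩ := hg x
        simpa using LinearMap.congr_fun h2 y⟩
      ext_closed := fun M A hA hQ => ⟨T.2.ext_closed M A hA.1 hQ.1, fun I hI f => by
        have h2 := hA.2 I hI (f ∘ₗ A.subtype)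
        have h3 : A ≤ LinearMap.ker f := fun a ha => by
          simpa using LinearMap.congr_fun h2 ⟨a, ha⟩
        have h4 := hQ.2 I hI (A.liftQ f h3)
        ext x
        simpa using LinearMap.congr_fun h4 (Submodule.Quotient.mk x)⟩ }⟩

/-- intersection of a set of torsion classes with `T` -/
def interT (T : TorsionClass K Λ) (s : Set (TorsionClass K Λ)) : TorsionClass K Λ :=
  ⟨{M | M ∈ T.1 ∧ ∀ S ∈ s, M ∈ S.1},
    { iso_closed := fun M N e h =>
        ⟨T.2.iso_closed M N e h.1, fun S hS => S.2.iso_closed M N e (h.2 S hS)⟩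
      finDim := fun M h => T.2.finDim M h.1
      zero_mem := fun M h => ⟨T.2.zero_mem M h, fun S _ => S.2.zero_mem M h⟩
      quot_closed := fun M N g hg h =>
        ⟨T.2.quot_closed M N g hg h.1, fun S hS => S.2.quot_closed M N g hg (h.2 S hS)⟩
      ext_closed := fun M A hA hQ => ⟨T.2.ext_closed M A hA.1 hQ.1,
        fun S hS => S.2.ext_closed M A (hA.2 S hS) (hQ.2 S hS)⟩ }⟩

theorem exists_lub [FiniteDimensional K Λ] (s : Set (TorsionClass K Λ)) :
    ∃ T, IsLUB s T := by
  refine ⟨interT (topT K Λ) (upperBounds s), ?_, ?_⟩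
  · intro S hS M hM
    exact ⟨le_topT S hM, fun Q hQ => hQ hS hM⟩
  · intro Q hQ M hM
    exact hM.2 Q hQ

/-- The data attached to a cover relation of torsion classes. -/
structure IsLabel (S T : TorsionClass K Λ) (B : RMod Λ) : Prop where
  mem : B ∈ T.1
  perp : B ∈ Perp Λ S.1
  ne : ∃ b : B, b ≠ 0
  surj : ∀ N ∈ T.1, ∀ f : N →ₗ[Λᵐᵒᵖ] B, f ≠ 0 → Function.Surjective f
  of_hom : ∀ N ∈ T.1, (∀ f : N →ₗ[Λᵐᵒᵖ] B, f = 0) → N ∈ S.1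
  ker : ∀ N ∈ T.1, ∀ f : N →ₗ[Λᵐᵒᵖ] B, ModuleCat.of Λᵐᵒᵖ (LinearMap.ker f) ∈ T.1
  up : ∀ R : TorsionClass K Λ, S ≤ R → B ∈ R.1 → T ≤ R
  hom : ∀ N ∈ Perp Λ S.1, N ∉ Perp Λ T.1 → ∃ g : B →ₗ[Λᵐᵒᵖ] N, g ≠ 0

/-- The common core: homs from labels to torsion-free modules are injective with torsion-free
cokernel. -/
theorem coker_core (S T : TorsionClass K Λ) (𝓑 : Set (RMod Λ))
    (hmem : ∀ B ∈ 𝓑, B ∈ T.1) (hperp : ∀ B ∈ 𝓑, B ∈ Perp Λ S.1) (hST : S ≤ T)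
    (hsurj : ∀ B ∈ 𝓑, ∀ N ∈ T.1, ∀ f : N →ₗ[Λᵐᵒᵖ] B, f ≠ 0 → Function.Surjective f)
    (hof : ∀ N ∈ T.1, (∀ B ∈ 𝓑, ∀ f : N →ₗ[Λᵐᵒᵖ] B, f = 0) → N ∈ S.1)
    (hker : ∀ B ∈ 𝓑, ∀ N ∈ T.1, ∀ f : N →ₗ[Λᵐᵒᵖ] B,
      ModuleCat.of Λᵐᵒᵖ (LinearMap.ker f) ∈ T.1)
    (B : RMod Λ) (hB : B ∈ 𝓑) (N : RMod Λ) (hN : N ∈ Perp Λ S.1)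
    (g : B →ₗ[Λᵐᵒᵖ] N) (hg : g ≠ 0) :
    Function.Injective g ∧ ModuleCat.of Λᵐᵒᵖ (N ⧸ LinearMap.range g) ∈ Perp Λ S.1 := by
  -- nonzero maps between labels are bijective
  have hbij : ∀ B₂ ∈ 𝓑, ∀ f : B →ₗ[Λᵐᵒᵖ] B₂, f ≠ 0 → Function.Bijective f := by
    intro B₂ hB₂ f hf
    refine ⟨?_, hsurj B₂ hB₂ B (hmem B hB) f hf⟩
    rw [← LinearMap.ker_eq_bot]
    by_contra hne
    have h1 : (LinearMap.ker f).subtype ≠ 0 := fun h => hne (by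
      rw [eq_bot_iff]
      intro x hx
      simpa using LinearMap.congr_fun h ⟨x, hx⟩)
    have h2 := hsurj B hB _ (hker B₂ hB₂ B (hmem B hB) f) (LinearMap.ker f).subtype h1
    apply hf
    ext x
    obtain ⟨y, rfl⟩ := h2 x
    simpa using y.2
  constructor
  · have h1 : ModuleCat.of Λᵐᵒᵖ (LinearMap.range g) ∉ S.1 := fun h => hg (by
      have := hN _ h (LinearMap.range g).subtype
      ext x
      simpa using LinearMap.congr_fun this ⟨g x, x, rfl⟩)
    have h2 : ∃ B₂ ∈ 𝓑, ∃ f : LinearMap.range g →ₗ[Λᵐᵒᵖ] B₂, f ≠ 0 := by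
      by_contra! h
      exact h1 (hof _ (range_mem T g (hmem B hB)) h)
    obtain ⟨B₂, hB₂, f, hf⟩ := h2
    have h3 : f ∘ₗ g.rangeRestrict ≠ 0 := fun h => hf (by
      ext x
      obtain ⟨y, rfl⟩ := g.surjective_rangeRestrict x
      simpa using LinearMap.congr_fun h y)
    have h4 := (hbij B₂ hB₂ _ h3).1
    intro x y hxy
    apply h4
    have : g.rangeRestrict x = g.rangeRestrict y := Subtype.ext hxy
    simp [this]
  · intro M hM m
    let P : Submodule Λᵐᵒᵖ N := (LinearMap.range m).comap (LinearMap.range g).mkQ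
    have hgP : ∀ x, g x ∈ P := fun x => by
      refine ⟨0, ?_⟩
      rw [map_zero]
      symm
      exact (Submodule.Quotient.mk_eq_zero _).2 ⟨x, rfl⟩
    let f : P →ₗ[Λᵐᵒᵖ] LinearMap.range m :=
      ((LinearMap.range g).mkQ ∘ₗ P.subtype).codRestrict _ (fun x => x.2)
    have hf : Function.Surjective f := by
      rintro ⟨y, hy⟩
      obtain ⟨n, rfl⟩ := (LinearMap.range g).mkQ_surjective y
      exact ⟨⟨n, hy⟩, rfl⟩
    have hfk : ∀ x, f x = 0 ↔ ∃ b, g b = x.1 := by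
      intro x
      constructor
      · intro h
        have h' := congrArg Subtype.val h
        exact (Submodule.Quotient.mk_eq_zero _).1 h'
      · intro h
        apply Subtype.ext
        exact (Submodule.Quotient.mk_eq_zero _).2 h
    let g' : B →ₗ[Λᵐᵒᵖ] P := g.codRestrict _ hgP
    have hg' : g' ≠ 0 := fun h => hg (by
      ext x
      simpa [g'] using congrArg Subtype.val (LinearMap.congr_fun h x))
    have hR : ModuleCat.of Λᵐᵒᵖ (LinearMap.range m) ∈ S.1 := range_mem S m hM
    have hPT : ModuleCat.of Λᵐᵒᵖ P ∈ T.1 := by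
      refine ext_mem T (A := B) (M := ModuleCat.of Λᵐᵒᵖ P)
        (N := ModuleCat.of Λᵐᵒᵖ (LinearMap.range m)) g' f hf ?_ (hmem B hB) (hST hR)
      ext x
      rw [LinearMap.mem_ker, LinearMap.mem_range]
      refine Iff.trans ?_ (hfk x).symm
      exact ⟨fun ⟨b, hb⟩ => ⟨b, congrArg Subtype.val hb⟩, fun ⟨b, hb⟩ => ⟨b, Subtype.ext hb⟩⟩
    have hPp : ModuleCat.of Λᵐᵒᵖ P ∈ Perp Λ S.1 := perp_sub hN P
    have hPS : ModuleCat.of Λᵐᵒᵖ P ∉ S.1 := fun h => hg' (by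
      ext x
      exact congrArg Subtype.val (eq_zero_of_mem_perp h hPp (g' x)))
    have h2 : ∃ B₂ ∈ 𝓑, ∃ h : P →ₗ[Λᵐᵒᵖ] B₂, h ≠ 0 := by
      by_contra! h
      exact hPS (hof _ hPT h)
    obtain ⟨B₂, hB₂, h, hh⟩ := h2
    have hcomp : h ∘ₗ g' ≠ 0 := fun h0 => hh (by
      refine zero_of_ker_le S (M := ModuleCat.of Λᵐᵒᵖ P)
        (N := ModuleCat.of Λᵐᵒᵖ (LinearMap.range m)) f hf hR (hperp B₂ hB₂) h ?_
      intro x hx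
      obtain ⟨b, hb⟩ := (hfk x).1 hx
      have : x = g' b := Subtype.ext hb.symm
      rw [this]
      exact LinearMap.congr_fun h0 b)
    let e := LinearEquiv.ofBijective (h ∘ₗ g') (hbij B₂ hB₂ _ hcomp)
    let π : P →ₗ[Λᵐᵒᵖ] P := LinearMap.id - g' ∘ₗ e.symm.toLinearMap ∘ₗ h
    have hπ : π = 0 := by
      refine zero_of_ker_le S (M := ModuleCat.of Λᵐᵒᵖ P)
        (N := ModuleCat.of Λᵐᵒᵖ (LinearMap.range m)) f hf hR hPp π ?_
      intro x hx
      obtain ⟨b, hb⟩ := (hfk x).1 hx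
      have hx' : x = g' b := Subtype.ext hb.symm
      have : e.symm (h (g' b)) = b := e.symm_apply_apply b
      rw [hx', LinearMap.mem_ker]
      change g' b - g' (e.symm (h (g' b))) = 0
      rw [this, sub_self]
    ext z
    obtain ⟨n, hn⟩ := (LinearMap.range g).mkQ_surjective (m z)
    have hnP : n ∈ P := ⟨z, hn.symm⟩
    have h5 := LinearMap.congr_fun hπ ⟨n, hnP⟩
    have h6 : (⟨n, hnP⟩ : P) = g' (e.symm (h ⟨n, hnP⟩)) := sub_eq_zero.1 h5
    have h7 : n = g (e.symm (h ⟨n, hnP⟩)) := congrArg Subtype.val h6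
    rw [← hn]
    exact (Submodule.Quotient.mk_eq_zero _).2 ⟨_, h7.symm⟩

theorem IsLabel.coker {S T : TorsionClass K Λ} {B : RMod Λ} (hL : IsLabel S T B) (hST : S ≤ T)
    (N : RMod Λ) (hN : N ∈ Perp Λ S.1) (g : B →ₗ[Λᵐᵒᵖ] N) (hg : g ≠ 0) :
    Function.Injective g ∧ ModuleCat.of Λᵐᵒᵖ (N ⧸ LinearMap.range g) ∈ Perp Λ S.1 := by
  refine coker_core S T {B} ?_ ?_ hST ?_ ?_ ?_ B rfl N hN g hg
  · rintro _ rfl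
    exact hL.mem
  · rintro _ rfl
    exact hL.perp
  · rintro _ rfl
    exact hL.surj
  · intro N hN h
    exact hL.of_hom N hN (h B rfl)
  · rintro _ rfl
    exact hL.ker


theorem exists_label [FiniteDimensional K Λ] {S T : TorsionClass K Λ} (hc : S ⋖ T) :
    ∃ B, IsLabel S T B := by
  have hST : S ≤ T := hc.le
  -- a module of `T` not in `S`, divided by a maximal submodule in `S`
  have h0 : ∃ M, M ∈ T.1 ∧ M ∉ S.1 := by
    by_contra! h
    exact hc.lt.not_ge h
  obtain ⟨M₀, hM₀T, hM₀S⟩ := h0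
  have h1 : ∃ M, M ∈ T.1 ∧ M ∈ Perp Λ S.1 ∧ ∃ m : M, m ≠ 0 := by
    have := noetherian_of_mem T hM₀T
    obtain ⟨A, hA, hmax⟩ := WellFounded.has_min
      (wellFounded_gt : WellFounded ((· > ·) : Submodule Λᵐᵒᵖ M₀ → Submodule Λᵐᵒᵖ M₀ → Prop))
      {A | ModuleCat.of Λᵐᵒᵖ A ∈ S.1}
      ⟨⊥, S.2.zero_mem (ModuleCat.of Λᵐᵒᵖ (⊥ : Submodule Λᵐᵒᵖ M₀))
        (inferInstanceAs (Subsingleton (⊥ : Submodule Λᵐᵒᵖ M₀)))⟩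
    refine ⟨ModuleCat.of Λᵐᵒᵖ (M₀ ⧸ A), T.2.quot_closed M₀ _ A.mkQ A.mkQ_surjective hM₀T,
      ?_, ?_⟩
    · intro N hN f
      let P : Submodule Λᵐᵒᵖ M₀ := (LinearMap.range f).comap A.mkQ
      have hAP : A ≤ P := fun a ha => by
        refine ⟨0, ?_⟩
        rw [map_zero]
        exact ((Submodule.Quotient.mk_eq_zero _).2 ha).symm
      have hP : ModuleCat.of Λᵐᵒᵖ P ∈ S.1 := by
        refine ext_mem S (A := ModuleCat.of Λᵐᵒᵖ A) (M := ModuleCat.of Λᵐᵒᵖ P)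
          (N := ModuleCat.of Λᵐᵒᵖ (LinearMap.range f)) (Submodule.inclusion hAP)
          ((A.mkQ ∘ₗ P.subtype).codRestrict _ (fun x => x.2)) ?_ ?_ hA (range_mem S f hN)
        · rintro ⟨y, hy⟩
          obtain ⟨n, rfl⟩ := A.mkQ_surjective y
          exact ⟨⟨n, hy⟩, rfl⟩
        · ext x
          rw [LinearMap.mem_ker, LinearMap.mem_range]
          constructor
          · rintro ⟨a, rfl⟩
            exact Subtype.ext ((Submodule.Quotient.mk_eq_zero _).2 a.2)
          · intro h
            have h' := (Submodule.Quotient.mk_eq_zero _).1 (congrArg Subtype.val h)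
            exact ⟨⟨_, h'⟩, rfl⟩
      have hPA : P = A := by
        by_contra hne
        exact hmax P hP (lt_of_le_of_ne hAP (Ne.symm hne))
      ext z
      obtain ⟨n, hn⟩ := A.mkQ_surjective (f z)
      have hnP : n ∈ P := ⟨z, hn.symm⟩
      rw [hPA] at hnP
      rw [← hn]
      exact (Submodule.Quotient.mk_eq_zero _).2 hnP
    · by_contra! h
      apply hM₀S
      have hAt : A = ⊤ := by
        rw [eq_top_iff]
        intro x _
        exact (Submodule.Quotient.mk_eq_zero _).1 (h (Submodule.Quotient.mk x))
      subst hAt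
      exact S.2.iso_closed _ M₀ Submodule.topEquiv hA
  obtain ⟨M, hMT, hMp, m, hm⟩ := h1
  have := artinian_of_mem T hMT
  obtain ⟨A, ⟨hAT, hA0⟩, hmin⟩ := WellFounded.has_min
      (wellFounded_lt : WellFounded ((· < ·) : Submodule Λᵐᵒᵖ M → Submodule Λᵐᵒᵖ M → Prop))
      {A | ModuleCat.of Λᵐᵒᵖ A ∈ T.1 ∧ A ≠ ⊥}
      ⟨⊤, T.2.iso_closed M (ModuleCat.of Λᵐᵒᵖ (⊤ : Submodule Λᵐᵒᵖ M)) Submodule.topEquiv.symm hMT,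
        fun h => hm (by
          have : m ∈ (⊤ : Submodule Λᵐᵒᵖ M) := trivial
          rw [h] at this
          simpa using this)⟩
  have hAp : ModuleCat.of Λᵐᵒᵖ A ∈ Perp Λ S.1 := perp_sub hMp A
  obtain ⟨a, haA, ha0⟩ := Submodule.exists_mem_ne_zero_of_ne_bot hA0
  have hne : ∃ b : A, b ≠ 0 := ⟨⟨a, haA⟩, fun h => ha0 (congrArg Subtype.val h)⟩
  have hsurj : ∀ N ∈ T.1, ∀ f : N →ₗ[Λᵐᵒᵖ] A, f ≠ 0 → Function.Surjective f := by
    intro N hN f hf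
    have h2 : LinearMap.range (A.subtype ∘ₗ f) = A := by
      by_contra hne2
      refine hmin (LinearMap.range (A.subtype ∘ₗ f)) ⟨range_mem T (A.subtype ∘ₗ f) hN, ?_⟩
        (lt_of_le_of_ne ?_ hne2)
      · intro hb
        rw [LinearMap.range_eq_bot] at hb
        apply hf
        ext x
        simpa using LinearMap.congr_fun hb x
      · rintro _ ⟨x, rfl⟩
        exact (f x).2
    rintro ⟨y, hy⟩
    rw [← h2] at hy
    obtain ⟨x, hx⟩ := hy
    exact ⟨x, Subtype.ext hx⟩
  -- order facts
  have hup : ∀ R : TorsionClass K Λ, S ≤ R → ModuleCat.of Λᵐᵒᵖ A ∈ R.1 → T ≤ R := by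
    intro R hSR hAR
    have h3 : S < interT T {R} := by
      refine lt_of_le_not_ge (fun N hN => ⟨hST hN, ?_⟩) (fun h => ?_)
      · rintro _ rfl
        exact hSR hN
      · have h4 : ModuleCat.of Λᵐᵒᵖ A ∈ S.1 := h ⟨hAT, by
          rintro _ rfl
          exact hAR⟩
        obtain ⟨b, hb⟩ := hne
        exact hb (eq_zero_of_mem_perp h4 hAp b)
    have h5 : interT T {R} ≤ T := fun N hN => hN.1
    have h6 : interT T {R} = T := by
      by_contra hne2
      exact hc.2 h3 (lt_of_le_of_ne h5 hne2)
    intro N hN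
    rw [← h6] at hN
    exact hN.2 R rfl
  have hof : ∀ N ∈ T.1, (∀ f : N →ₗ[Λᵐᵒᵖ] A, f = 0) → N ∈ S.1 := by
    intro N hN h
    have h3 : S ≤ leftPerp T {ModuleCat.of Λᵐᵒᵖ A} := by
      intro X hX
      refine ⟨hST hX, ?_⟩
      rintro _ rfl
      exact hAp X hX
    have h4 : leftPerp T {ModuleCat.of Λᵐᵒᵖ A} < T := by
      refine lt_of_le_not_ge (fun X hX => hX.1) (fun h' => ?_)
      obtain ⟨b, hb⟩ := hne
      have := (h' hAT).2 _ rfl LinearMap.id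
      exact hb (LinearMap.congr_fun this b)
    have h5 : S = leftPerp T {ModuleCat.of Λᵐᵒᵖ A} := by
      by_contra hne2
      exact hc.2 (lt_of_le_of_ne h3 hne2) h4
    rw [h5]
    refine ⟨hN, ?_⟩
    rintro _ rfl
    exact h
  have hhom : ∀ N ∈ Perp Λ S.1, N ∉ Perp Λ T.1 → ∃ g : A →ₗ[Λᵐᵒᵖ] N, g ≠ 0 := by
    intro N hN hNT
    by_contra! h
    apply hNT
    intro X hX f
    have h3 : T ≤ leftPerp T {N} := by
      refine hup _ (fun X hX => ⟨hST hX, ?_⟩) ⟨hAT, ?_⟩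
      · rintro _ rfl
        exact hN X hX
      · rintro _ rfl
        exact h
    exact (h3 hX).2 N rfl f
  refine ⟨ModuleCat.of Λᵐᵒᵖ A, hAT, hAp, hne, hsurj, hof, ?_, hup, hhom⟩
  -- kernels
  intro N hN f
  by_cases hf : f = 0
  · subst hf
    refine T.2.iso_closed N _ ?_ hN
    exact (Submodule.topEquiv.symm.trans (LinearEquiv.ofEq _ _ LinearMap.ker_zero.symm))
  have hfs := hsurj N hN f hf
  have := noetherian_of_mem T hN
  obtain ⟨C, ⟨hCT, hCk⟩, hmax⟩ := WellFounded.has_min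
      (wellFounded_gt : WellFounded ((· > ·) : Submodule Λᵐᵒᵖ N → Submodule Λᵐᵒᵖ N → Prop))
      {C | ModuleCat.of Λᵐᵒᵖ C ∈ T.1 ∧ C ≤ LinearMap.ker f}
      ⟨⊥, T.2.zero_mem (ModuleCat.of Λᵐᵒᵖ (⊥ : Submodule Λᵐᵒᵖ N))
        (inferInstanceAs (Subsingleton (⊥ : Submodule Λᵐᵒᵖ N))), bot_le⟩
  -- any map from `T` to `N / C` landing in the kernel vanishes
  let f' : (N ⧸ C) →ₗ[Λᵐᵒᵖ] A := C.liftQ f hCk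
  have hzero : ∀ X ∈ T.1, ∀ g : X →ₗ[Λᵐᵒᵖ] (N ⧸ C), f' ∘ₗ g = 0 → g = 0 := by
    intro X hX g hg
    let P : Submodule Λᵐᵒᵖ N := (LinearMap.range g).comap C.mkQ
    have hCP : C ≤ P := fun a ha => by
      refine ⟨0, ?_⟩
      rw [map_zero]
      exact ((Submodule.Quotient.mk_eq_zero _).2 ha).symm
    have hP : ModuleCat.of Λᵐᵒᵖ P ∈ T.1 := by
      refine ext_mem T (A := ModuleCat.of Λᵐᵒᵖ C) (M := ModuleCat.of Λᵐᵒᵖ P)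
        (N := ModuleCat.of Λᵐᵒᵖ (LinearMap.range g)) (Submodule.inclusion hCP)
        ((C.mkQ ∘ₗ P.subtype).codRestrict _ (fun x => x.2)) ?_ ?_ hCT
        (range_mem T (N := ModuleCat.of Λᵐᵒᵖ (N ⧸ C)) g hX)
      · rintro ⟨y, hy⟩
        obtain ⟨n, rfl⟩ := C.mkQ_surjective y
        exact ⟨⟨n, hy⟩, rfl⟩
      · ext x
        rw [LinearMap.mem_ker, LinearMap.mem_range]
        constructor
        · rintro ⟨a, rfl⟩
          exact Subtype.ext ((Submodule.Quotient.mk_eq_zero _).2 a.2)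
        · intro h
          have h' := (Submodule.Quotient.mk_eq_zero _).1 (congrArg Subtype.val h)
          exact ⟨⟨_, h'⟩, rfl⟩
    have hPk : P ≤ LinearMap.ker f := by
      rintro x ⟨z, hz⟩
      have := LinearMap.congr_fun hg z
      rw [LinearMap.comp_apply, hz] at this
      exact this
    have hPC : P = C := by
      by_contra hne2
      exact hmax P ⟨hP, hPk⟩ (lt_of_le_of_ne hCP (Ne.symm hne2))
    ext z
    obtain ⟨n, hn⟩ := C.mkQ_surjective (g z)
    have hnP : n ∈ P := ⟨z, hn.symm⟩
    rw [hPC] at hnP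
    rw [← hn]
    exact (Submodule.Quotient.mk_eq_zero _).2 hnP
  have hQT : ModuleCat.of Λᵐᵒᵖ (N ⧸ C) ∈ T.1 := T.2.quot_closed N _ C.mkQ C.mkQ_surjective hN
  have hQp : ModuleCat.of Λᵐᵒᵖ (N ⧸ C) ∈ Perp Λ S.1 := by
    intro X hX g
    exact hzero X (hST hX) g (hAp X hX (f' ∘ₗ g))
  have hf'0 : f' ≠ 0 := fun h => hf (by
    ext x
    exact congrArg Subtype.val (LinearMap.congr_fun h (Submodule.Quotient.mk x)))
  have hQn : ModuleCat.of Λᵐᵒᵖ (N ⧸ C) ∉ Perp Λ T.1 := fun h => hf'0 (by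
    ext x
    have : Submodule.Quotient.mk x = (0 : N ⧸ C) := eq_zero_of_mem_perp hQT h _
    simp [this])
  obtain ⟨g, hg⟩ := hhom _ hQp hQn
  have hfg : f' ∘ₗ g ≠ 0 := fun h => hg (hzero _ hAT g h)
  have hfgs : Function.Surjective (f' ∘ₗ g) := hsurj _ hAT _ hfg
  have hnA : IsNoetherian Λᵐᵒᵖ A := noetherian_of_mem T hAT
  have hfgb : Function.Bijective (f' ∘ₗ g) :=
    ⟨IsNoetherian.injective_of_surjective_endomorphism _ hfgs, hfgs⟩
  let e := LinearEquiv.ofBijective (f' ∘ₗ g) hfgb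
  let π : (N ⧸ C) →ₗ[Λᵐᵒᵖ] (N ⧸ C) := LinearMap.id - g ∘ₗ e.symm.toLinearMap ∘ₗ f'
  have hπ : π = 0 := by
    refine hzero _ hQT π ?_
    ext x
    have h : (f' ∘ₗ g) (e.symm (f' (Submodule.Quotient.mk x))) = f' (Submodule.Quotient.mk x) :=
      e.apply_symm_apply _
    have h' : f' (Submodule.Quotient.mk x - g (e.symm (f' (Submodule.Quotient.mk x)))) = 0 := by
      rw [map_sub, sub_eq_zero]
      exact h.symm
    exact congrArg Subtype.val h'
  have hkC : LinearMap.ker f = C := by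
    refine le_antisymm (fun x hx => ?_) hCk
    have h := LinearMap.congr_fun hπ (Submodule.Quotient.mk x)
    have h' : (Submodule.Quotient.mk x : N ⧸ C)
        = g (e.symm (f' (Submodule.Quotient.mk x))) := sub_eq_zero.1 h
    have h'' : f' (Submodule.Quotient.mk x) = 0 := hx
    rw [h'', map_zero, map_zero] at h'
    exact (Submodule.Quotient.mk_eq_zero _).1 h'
  rw [hkC]
  exact hCT


/-- a map from a minimal module of `W_U` to a torsion-free module is zero or injective -/
theorem uset_hom {𝒯 : Set (RMod Λ)} {U : RMod Λ} (hU : U ∈ USet Λ 𝒯) (N : RMod Λ)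
    (hN : N ∈ Perp Λ 𝒯) (f : U →ₗ[Λᵐᵒᵖ] N) : f = 0 ∨ Function.Injective f := by
  obtain ⟨⟨hUp, hUc⟩, -, hmin⟩ := hU
  have hK : ModuleCat.of Λᵐᵒᵖ (LinearMap.ker f) ∈ WUpper Λ 𝒯 := by
    refine ⟨perp_sub hUp _, ?_⟩
    intro N' hN' g
    -- the pushout of `g` and the inclusion
    let j : LinearMap.ker f →ₗ[Λᵐᵒᵖ] (N' × U) := g.prod (-(LinearMap.ker f).subtype)
    let D : Submodule Λᵐᵒᵖ (N' × U) := LinearMap.range j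
    let q : ((N' × U) ⧸ D) →ₗ[Λᵐᵒᵖ] N := D.liftQ (f ∘ₗ LinearMap.snd Λᵐᵒᵖ N' U) (by
      rintro _ ⟨k, rfl⟩
      have := k.2
      simp [j])
    let i : N' →ₗ[Λᵐᵒᵖ] ((N' × U) ⧸ D) := D.mkQ ∘ₗ LinearMap.inl Λᵐᵒᵖ N' U
    have hi : Function.Injective i := by
      rw [← LinearMap.ker_eq_bot, eq_bot_iff]
      intro x hx
      obtain ⟨k, hk⟩ := (Submodule.Quotient.mk_eq_zero D).1 hx
      have h1 : g k = x := congrArg Prod.fst hk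
      have h2 : -(k : U) = 0 := congrArg Prod.snd hk
      have h3 : k = 0 := Subtype.ext (neg_eq_zero.1 h2)
      rw [h3, map_zero] at h1
      exact h1.symm
    have hP : ModuleCat.of Λᵐᵒᵖ ((N' × U) ⧸ D) ∈ Perp Λ 𝒯 := by
      intro X hX a
      have h1 := hN X hX (q ∘ₗ a)
      have h2 : ∀ x, a x ∈ LinearMap.range i := by
        intro x
        obtain ⟨⟨n, u⟩, hnu⟩ := D.mkQ_surjective (a x)
        have h3 := LinearMap.congr_fun h1 x
        rw [LinearMap.comp_apply, ← hnu] at h3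
        have h4 : f u = 0 := h3
        refine ⟨n + g ⟨u, h4⟩, ?_⟩
        rw [← hnu]
        refine (Submodule.Quotient.eq D).2 ⟨⟨u, h4⟩, ?_⟩
        ext <;> simp [j]
      let ei := LinearEquiv.ofInjective i hi
      have h3 := hN' X hX (ei.symm.toLinearMap ∘ₗ a.codRestrict _ h2)
      ext x
      have h4 := LinearMap.congr_fun h3 x
      have h5 : a.codRestrict _ h2 x = 0 := by
        apply ei.symm.injective
        rw [map_zero]
        exact h4
      exact congrArg Subtype.val h5
    let r : U →ₗ[Λᵐᵒᵖ] ((N' × U) ⧸ D) := D.mkQ ∘ₗ LinearMap.inr Λᵐᵒᵖ N' U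
    have hc := hUc _ hP r
    have hle : LinearMap.range g ≤ (LinearMap.range r).comap i := by
      rintro _ ⟨k, rfl⟩
      refine ⟨k.1, ?_⟩
      refine ((Submodule.Quotient.eq D).2 ⟨k, ?_⟩).symm
      ext <;> simp [j]
    refine perp_inj (M := ModuleCat.of Λᵐᵒᵖ (N' ⧸ LinearMap.range g)) hc
      ((LinearMap.range g).mapQ (LinearMap.range r) i hle) ?_
    rw [← LinearMap.ker_eq_bot, eq_bot_iff]
    intro x hx
    obtain ⟨n, rfl⟩ := (LinearMap.range g).mkQ_surjective x
    obtain ⟨u, hu⟩ := (Submodule.Quotient.mk_eq_zero (LinearMap.range r)).1 hx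
    obtain ⟨k, hk⟩ := (Submodule.Quotient.eq D).1 hu
    have h1 : g k = 0 - n := congrArg Prod.fst hk
    refine (Submodule.mem_bot _).2 ((Submodule.Quotient.mk_eq_zero _).2 ⟨-k, ?_⟩)
    rw [map_neg, h1]
    simp
  rcases hmin _ hK with h | h
  · right
    exact LinearMap.ker_eq_bot.1 h
  · left
    exact LinearMap.ker_eq_top.1 h

theorem exists_cover_above [Finite (TorsionClass K Λ)] {S T : TorsionClass K Λ} (h : S < T) :
    ∃ Q, S ⋖ Q ∧ Q ≤ T := exists_covBy_le_of_lt h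

theorem exists_cover_below [Finite (TorsionClass K Λ)] {S T : TorsionClass K Λ} (h : S < T) :
    ∃ Q, S ≤ Q ∧ Q ⋖ T := exists_le_covBy_of_lt h

theorem injective_quot_range {M N : RMod Λ} (g : M →ₗ[Λᵐᵒᵖ] N)
    (h : Function.Injective (LinearMap.range g).mkQ) : g = 0 := by
  ext x
  apply h
  rw [LinearMap.zero_apply, map_zero]
  exact (Submodule.Quotient.mk_eq_zero _).2 ⟨x, rfl⟩

theorem quot_range_zero {M N : RMod Λ} (g : M →ₗ[Λᵐᵒᵖ] N)
    (h : (LinearMap.range g).mkQ = 0) : Function.Surjective g := by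
  intro x
  exact (Submodule.Quotient.mk_eq_zero (LinearMap.range g)).1 (LinearMap.congr_fun h x)

theorem finite_of_hom [FiniteDimensional K Λ] [Finite (TorsionClass K Λ)] {U : RMod Λ}
    (hU0 : ∃ u : U, u ≠ 0) (T : TorsionClass K Λ) (hUp : U ∈ Perp Λ T.1)
    (hU : ∀ N ∈ Perp Λ T.1, ∀ f : U →ₗ[Λᵐᵒᵖ] N, f = 0 ∨ Function.Injective f) :
    Module.Finite Λᵐᵒᵖ U := by
  induction T using WellFoundedGT.induction with
  | ind T ih =>
    by_cases hT : T = topT K Λ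
    · exfalso
      obtain ⟨u, hu⟩ := hU0
      have h1 : ModuleCat.of Λᵐᵒᵖ (LinearMap.range (LinearMap.toSpanSingleton Λᵐᵒᵖ U u)) ∈ T.1 := by
        rw [hT]
        exact (inferInstance :
          Module.Finite Λᵐᵒᵖ (LinearMap.range (LinearMap.toSpanSingleton Λᵐᵒᵖ U u)))
      have h2 := hUp _ h1 (LinearMap.range (LinearMap.toSpanSingleton Λᵐᵒᵖ U u)).subtype
      exact hu (LinearMap.congr_fun h2 ⟨u, 1, by simp⟩)
    · obtain ⟨T', hc, -⟩ := exists_cover_above (lt_of_le_of_ne (le_topT T) hT)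
      by_cases hUT : U ∈ Perp Λ T'.1
      · exact ih T' hc.lt hUT (fun N hN => hU N (perp_anti hc.le hN))
      · obtain ⟨B, hB⟩ := exists_label hc
        obtain ⟨g, hg⟩ := hB.hom U hUp hUT
        have hfB := finite_of_mem T' hB.mem
        rcases hU _ (hB.coker hc.le U hUp g hg).2 (LinearMap.range g).mkQ with h | h
        · exact Module.Finite.of_surjective g (quot_range_zero g h)
        · exact absurd (injective_quot_range g h) hg

/-- elements of `𝒰(T)` are labels of covers -/
theorem uset_cover [FiniteDimensional K Λ] [Finite (TorsionClass K Λ)] {U : RMod Λ}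
    (T : TorsionClass K Λ) (hU : U ∈ USet Λ T.1) : ∃ T', T ⋖ T' ∧ U ∈ T'.1 := by
  have hUf : Module.Finite Λᵐᵒᵖ U :=
    finite_of_hom hU.2.1 T hU.1.1 (fun N hN f => uset_hom hU N hN f)
  let Q := leftPerp (topT K Λ) {N | N ∈ Perp Λ T.1 ∧ ∀ f : U →ₗ[Λᵐᵒᵖ] N, f = 0}
  have hTQ : T < Q := by
    refine lt_of_le_not_ge (fun M hM => ⟨le_topT T hM, fun N hN f => hN.1 M hM f⟩) (fun h => ?_)
    have hUT : U ∈ T.1 := h ⟨hUf, fun N hN f => hN.2 f⟩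
    obtain ⟨u, hu⟩ := hU.2.1
    exact hu (eq_zero_of_mem_perp hUT hU.1.1 u)
  obtain ⟨T', hc, hT'Q⟩ := exists_cover_above hTQ
  obtain ⟨B, hB⟩ := exists_label hc
  have h1 : ∃ f : U →ₗ[Λᵐᵒᵖ] B, f ≠ 0 := by
    by_contra! h
    obtain ⟨b, hb⟩ := hB.ne
    exact hb (LinearMap.congr_fun ((hT'Q hB.mem).2 B ⟨hB.perp, h⟩ LinearMap.id) b)
  obtain ⟨f, hf⟩ := h1
  have hfi : Function.Injective f := (uset_hom hU B hB.perp f).resolve_left hf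
  have hcok := hU.1.2 B hB.perp f
  have hfs : Function.Surjective f := by
    apply quot_range_zero f
    by_contra h
    exact hf (injective_quot_range f (hB.coker hc.le _ hcok _ h).1)
  exact ⟨T', hc, T'.2.iso_closed B U (LinearEquiv.ofBijective f ⟨hfi, hfs⟩).symm hB.mem⟩

theorem filt_hom {𝒞 : Set (RMod Λ)} {Z Y : RMod Λ} (hZ : Z ∈ FiltSet Λ 𝒞)
    (h : ∀ C ∈ 𝒞, ∀ f : C →ₗ[Λᵐᵒᵖ] Y, f = 0) (p : Z →ₗ[Λᵐᵒᵖ] Y) : p = 0 := by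
  obtain ⟨r, c, hmono, h0, hlast, hstep⟩ := hZ
  have key : ∀ i : Fin (r + 1), c i ≤ LinearMap.ker p := by
    intro i
    induction i using Fin.induction with
    | zero => rw [h0]; exact bot_le
    | succ i ih =>
      obtain ⟨C, hC, ⟨e⟩⟩ := hstep i
      let q : (↥(c i.succ) ⧸ Submodule.comap (c i.succ).subtype (c i.castSucc)) →ₗ[Λᵐᵒᵖ] Y :=
        Submodule.liftQ _ (p ∘ₗ (c i.succ).subtype) (fun x hx => ih hx)
      have h1 := h C hC (q ∘ₗ e.symm.toLinearMap)
      intro x hx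
      have h2 := LinearMap.congr_fun h1 (e (Submodule.Quotient.mk ⟨x, hx⟩))
      have h3 : q (e.symm (e (Submodule.Quotient.mk ⟨x, hx⟩))) = 0 := h2
      rw [e.symm_apply_apply] at h3
      exact h3
  ext x
  have : x ∈ c (Fin.last r) := by rw [hlast]; trivial
  exact key _ this

theorem label_dset {R T : TorsionClass K Λ} {X : RMod Λ} (hX : IsLabel R T X) :
    X ∈ DSet Λ T.1 := by
  refine ⟨⟨hX.mem, hX.ker⟩, hX.ne, ?_⟩
  intro N hN
  by_cases h : N = ⊥
  · exact Or.inl h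
  · right
    have h1 : N.subtype ≠ 0 := fun h0 => h (by
      rw [eq_bot_iff]
      intro x hx
      exact LinearMap.congr_fun h0 ⟨x, hx⟩)
    have h2 := hX.surj _ hN.1 N.subtype h1
    rw [eq_top_iff]
    intro x _
    obtain ⟨y, rfl⟩ := h2 x
    exact y.2

theorem three_two [FiniteDimensional K Λ] [Finite (TorsionClass K Λ)] (T : TorsionClass K Λ)
    (h3 : ∀ X ∈ DSet Λ T.1, ∃ Z ∈ FiltSet Λ (USet Λ T.1),
        ∃ f : Z →ₗ[Λᵐᵒᵖ] X, Function.Surjective f) :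
    ∃ T₁ : TorsionClass K Λ, IsPopUp T T₁ ∧ IsPopDown T₁ T := by
  obtain ⟨T₁, hT₁⟩ := exists_lub (insert T {Q | T ⋖ Q})
  have hTT₁ : T ≤ T₁ := hT₁.1 (Set.mem_insert _ _)
  have hcov : ∀ Q, T ⋖ Q → Q ≤ T₁ := fun Q hQ => hT₁.1 (Set.mem_insert_of_mem _ hQ)
  refine ⟨T₁, hT₁, ?_, ?_⟩
  · -- `T` is a lower bound
    rintro S (rfl | hc)
    · exact hTT₁
    by_contra hTS
    obtain ⟨B, hB⟩ := exists_label (show S ⋖ T₁ from hc)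
    obtain ⟨M, hMT, hMS⟩ : ∃ M, M ∈ T.1 ∧ M ∉ S.1 := by
      by_contra! h
      exact hTS h
    have hBT : B ∈ T.1 := by
      by_contra hBT
      apply hMS
      refine hB.of_hom M (hTT₁ hMT) (fun f => ?_)
      by_contra hf
      exact hBT (T.2.quot_closed M B f (hB.surj M (hTT₁ hMT) f hf) hMT)
    have hlt : interT T {S} < T := by
      refine lt_of_le_not_ge (fun N hN => hN.1) (fun h => hMS ((h hMT).2 S rfl))
    obtain ⟨R, hR, hRT⟩ := exists_cover_below hlt
    obtain ⟨X, hX⟩ := exists_label hRT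
    obtain ⟨Z, hZ, z, hz⟩ := h3 X (label_dset hX)
    have hXR : X ∉ R.1 := fun h => by
      obtain ⟨x, hx⟩ := hX.ne
      exact hx (eq_zero_of_mem_perp h hX.perp x)
    have hXS : X ∉ S.1 := fun h => hXR (hR ⟨hX.mem, by
      rintro _ rfl
      exact h⟩)
    have h1 : ∃ p : X →ₗ[Λᵐᵒᵖ] B, p ≠ 0 := by
      by_contra! h
      exact hXS (hB.of_hom X (hTT₁ hX.mem) h)
    obtain ⟨p, hp⟩ := h1
    have hpz : p ∘ₗ z ≠ 0 := fun h => hp (by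
      ext x
      obtain ⟨y, rfl⟩ := hz x
      exact LinearMap.congr_fun h y)
    have h2 : ∃ U ∈ USet Λ T.1, ∃ g : U →ₗ[Λᵐᵒᵖ] B, g ≠ 0 := by
      by_contra! h
      exact hpz (filt_hom hZ h _)
    obtain ⟨U, hU, g, hg⟩ := h2
    obtain ⟨T', hc', hUT'⟩ := uset_cover T hU
    have hUT₁ : U ∈ T₁.1 := hcov T' hc' hUT'
    have hgs := hB.surj U hUT₁ g hg
    have hY := hB.ker U hUT₁ g
    have hYp : ModuleCat.of Λᵐᵒᵖ (LinearMap.ker g) ∈ Perp Λ T.1 := perp_sub hU.1.1 _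
    have hYn : ∃ T'', T ⋖ T'' ∧ ModuleCat.of Λᵐᵒᵖ (LinearMap.ker g) ∉ Perp Λ T''.1 := by
      by_contra! h
      have h4 : T₁ ≤ leftPerp (topT K Λ) {ModuleCat.of Λᵐᵒᵖ (LinearMap.ker g)} := by
        refine hT₁.2 ?_
        rintro Q (rfl | hQ)
        · intro N hN
          refine ⟨le_topT _ hN, ?_⟩
          rintro _ rfl
          exact hYp N hN
        · intro N hN
          refine ⟨le_topT _ hN, ?_⟩
          rintro _ rfl
          exact h Q hQ N hN
      have h5 := (h4 hY).2 _ rfl LinearMap.id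
      have h6 : Function.Injective g := by
        rw [← LinearMap.ker_eq_bot, eq_bot_iff]
        intro x hx
        exact congrArg Subtype.val (LinearMap.congr_fun h5 ⟨x, hx⟩)
      have h7 : U ∈ T.1 :=
        T.2.iso_closed B U (LinearEquiv.ofBijective g ⟨h6, hgs⟩).symm hBT
      obtain ⟨u, hu⟩ := hU.2.1
      exact hu (eq_zero_of_mem_perp h7 hU.1.1 u)
    obtain ⟨T'', hc'', hYT''⟩ := hYn
    obtain ⟨B', hB'⟩ := exists_label hc''
    obtain ⟨b, hb⟩ := hB'.hom _ hYp hYT''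
    let b' : B' →ₗ[Λᵐᵒᵖ] U := (LinearMap.ker g).subtype ∘ₗ b
    have hb' : b' ≠ 0 := fun h => hb (by
      ext x
      exact LinearMap.congr_fun h x)
    rcases uset_hom hU _ (hB'.coker hc''.le U hU.1.1 b' hb').2 (LinearMap.range b').mkQ with h | h
    · have hs := quot_range_zero b' h
      apply hg
      ext x
      obtain ⟨y, rfl⟩ := hs x
      exact (b y).2
    · exact hb' (injective_quot_range b' h)
  · -- greatest
    intro R hR
    by_contra hRT
    have hRT₁ : R ≤ T₁ := hR (Set.mem_insert _ _)
    obtain ⟨Q, hQ⟩ := exists_lub {T, R}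
    have hTQ : T ≤ Q := hQ.1 (by simp)
    have hRQ : R ≤ Q := hQ.1 (by simp)
    have hlt : T < Q := lt_of_le_not_ge hTQ (fun h => hRT (hRQ.trans h))
    obtain ⟨T', hc, hT'Q⟩ := exists_cover_above hlt
    obtain ⟨B, hB⟩ := exists_label hc
    have hBT₁ : B ∈ T₁.1 := hcov T' hc hB.mem
    have hlt₁ : leftPerp T₁ {B} < T₁ := by
      refine lt_of_le_not_ge (fun N hN => hN.1) (fun h => ?_)
      obtain ⟨b, hb⟩ := hB.ne
      exact hb (LinearMap.congr_fun ((h hBT₁).2 B rfl LinearMap.id) b)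
    obtain ⟨S, hS, hc₁⟩ := exists_cover_below hlt₁
    have hTS : T ≤ S := by
      refine le_trans ?_ hS
      intro N hN
      refine ⟨hTT₁ hN, ?_⟩
      rintro _ rfl
      exact hB.perp N hN
    have hRS : R ≤ S := hR (Set.mem_insert_of_mem _ hc₁)
    have hQS : Q ≤ S := hQ.2 (by
      rintro _ (rfl | rfl)
      · exact hTS
      · exact hRS)
    have hBS : B ∈ S.1 := hQS (hT'Q hB.mem)
    have : T₁ ≤ S := by
      refine hT₁.2 ?_
      rintro T'' (rfl | hc'')
      · exact hTS
      obtain ⟨B'', hB''⟩ := exists_label (show T ⋖ T'' from hc'')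
      refine hB''.up S hTS ?_
      by_cases hz : ∀ f : B'' →ₗ[Λᵐᵒᵖ] B, f = 0
      · refine hS ⟨hcov T'' hc'' hB''.mem, ?_⟩
        rintro _ rfl
        exact hz
      · push Not at hz
        obtain ⟨f, hf⟩ := hz
        have hcok := hB''.coker (CovBy.le hc'') B hB.perp f hf
        have hfs : Function.Surjective f := by
          apply quot_range_zero f
          by_contra h
          exact hf (injective_quot_range f (hB.coker hc.le _ hcok.2 _ h).1)
        exact S.2.iso_closed B B'' (LinearEquiv.ofBijective f ⟨hcok.1, hfs⟩).symm hBS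
    exact hc₁.lt.not_ge this



/-- filtrations of a submodule `N` of `M`, indexed by natural numbers -/
def FiltSub (𝒞 : Set (RMod Λ)) {M : RMod Λ} (N : Submodule Λᵐᵒᵖ M) : Prop :=
  ∃ (r : ℕ) (c : ℕ → Submodule Λᵐᵒᵖ M), Monotone c ∧ c 0 = ⊥ ∧ c r = N ∧
    ∀ i, i < r → ∃ C ∈ 𝒞, Nonempty
      ((↥(c (i + 1)) ⧸ Submodule.comap (c (i + 1)).subtype (c i)) ≃ₗ[Λᵐᵒᵖ] C)

theorem filtSub_bot (𝒞 : Set (RMod Λ)) {M : RMod Λ} :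
    FiltSub 𝒞 (⊥ : Submodule Λᵐᵒᵖ M) :=
  ⟨0, fun _ => ⊥, fun _ _ _ => le_rfl, rfl, rfl, fun i hi => absurd hi (Nat.not_lt_zero i)⟩

theorem filtSub_step {𝒞 : Set (RMod Λ)} {M : RMod Λ} {N N' : Submodule Λᵐᵒᵖ M}
    (hN : FiltSub 𝒞 N) (hle : N ≤ N') {C : RMod Λ} (hC : C ∈ 𝒞)
    (e : (↥N' ⧸ Submodule.comap N'.subtype N) ≃ₗ[Λᵐᵒᵖ] C) : FiltSub 𝒞 N' := by
  obtain ⟨r, c, hm, h0, hr, hs⟩ := hN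
  refine ⟨r + 1, fun i => if i ≤ r then c i else N', ?_, ?_, ?_, ?_⟩
  · intro i j hij
    by_cases hj : j ≤ r
    · have hi : i ≤ r := hij.trans hj
      simpa [hi, hj] using hm hij
    · by_cases hi : i ≤ r
      · have h1 : c i ≤ N' := (hm hi).trans (hr.le.trans hle)
        simpa [hi, hj] using h1
      · simp [hi, hj]
  · simpa using h0
  · simp
  · intro i hi
    rcases Nat.lt_succ_iff_lt_or_eq.1 hi with h | h
    · have h1 : (if i + 1 ≤ r then c (i + 1) else N') = c (i + 1) := if_pos h
      have h2 : (if i ≤ r then c i else N') = c i := if_pos h.le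
      beta_reduce
      rw [h1, h2]
      exact hs i h
    · subst h
      have h1 : (if i + 1 ≤ i then c (i + 1) else N') = N' := if_neg (by omega)
      have h2 : (if i ≤ i then c i else N') = N := by rw [if_pos le_rfl, hr]
      beta_reduce
      rw [h1, h2]
      exact ⟨C, hC, ⟨e⟩⟩

theorem filtSub_top {𝒞 : Set (RMod Λ)} {M : RMod Λ}
    (h : FiltSub 𝒞 (⊤ : Submodule Λᵐᵒᵖ M)) : M ∈ FiltSet Λ 𝒞 := by
  obtain ⟨r, c, hm, h0, hr, hs⟩ := h
  exact ⟨r, fun i => c i.1, fun i j hij => hm hij, h0, hr, fun i => hs i.1 i.2⟩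

/-- if every nonzero submodule in `𝒢` maps onto an object of `𝒞` with kernel in `𝒢`,
then there are filtrations -/
theorem filt_of_peel {𝒞 𝒢 : Set (RMod Λ)} {M : RMod Λ} [IsArtinian Λᵐᵒᵖ M]
    (hiso : ∀ A B : RMod Λ, (A ≃ₗ[Λᵐᵒᵖ] B) → A ∈ 𝒢 → B ∈ 𝒢) (hM : M ∈ 𝒢)
    (hpeel : ∀ N ∈ 𝒢, (∃ n : N, n ≠ 0) → ∃ C ∈ 𝒞, ∃ f : N →ₗ[Λᵐᵒᵖ] C, f ≠ 0 ∧
      Function.Surjective f ∧ ModuleCat.of Λᵐᵒᵖ (LinearMap.ker f) ∈ 𝒢) :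
    M ∈ FiltSet Λ 𝒞 := by
  apply filtSub_top
  have key : ∀ N : Submodule Λᵐᵒᵖ M, ModuleCat.of Λᵐᵒᵖ N ∈ 𝒢 → FiltSub 𝒞 N := by
    intro N
    induction N using WellFoundedLT.induction with
    | ind N ih =>
      intro hN
      by_cases hb : N = ⊥
      · rw [hb]
        exact filtSub_bot 𝒞
      obtain ⟨a, haA, ha0⟩ := Submodule.exists_mem_ne_zero_of_ne_bot hb
      obtain ⟨C, hC, f, hf0, hfs, hfk⟩ := hpeel _ hN ⟨⟨a, haA⟩, fun h => ha0 (congrArg Subtype.val h)⟩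
      let f' : N →ₗ[Λᵐᵒᵖ] C := f
      let N₀ : Submodule Λᵐᵒᵖ M := (LinearMap.ker f').map N.subtype
      have hle : N₀ ≤ N := Submodule.map_subtype_le _ _
      have hcm : Submodule.comap N.subtype N₀ = LinearMap.ker f' :=
        Submodule.comap_map_eq_of_injective N.injective_subtype _
      have hlt : N₀ < N := by
        refine lt_of_le_of_ne hle (fun h => hf0 ?_)
        ext x
        have h1 : x ∈ Submodule.comap N.subtype N₀ := by
          rw [h]
          exact x.2
        rw [hcm] at h1
        exact h1
      have hN₀ : ModuleCat.of Λᵐᵒᵖ N₀ ∈ 𝒢 :=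
        hiso (ModuleCat.of Λᵐᵒᵖ (LinearMap.ker f')) (ModuleCat.of Λᵐᵒᵖ N₀)
          (Submodule.equivMapOfInjective N.subtype N.injective_subtype (LinearMap.ker f')) hfk
      refine filtSub_step (ih N₀ hlt hN₀) hle hC ?_
      rw [hcm]
      exact f'.quotKerEquivOfSurjective hfs
  exact key ⊤ (hiso M (ModuleCat.of Λᵐᵒᵖ (⊤ : Submodule Λᵐᵒᵖ M)) Submodule.topEquiv.symm hM)

/-- nonzero maps from `T` to elements of `𝒟(T)` are surjective -/
theorem dset_surj (T : TorsionClass K Λ) {X : RMod Λ} (hX : X ∈ DSet Λ T.1) (N : RMod Λ)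
    (hN : N ∈ T.1) (f : N →ₗ[Λᵐᵒᵖ] X) (hf : f ≠ 0) : Function.Surjective f := by
  obtain ⟨⟨hXT, hXk⟩, -, hmin⟩ := hX
  have hW : ModuleCat.of Λᵐᵒᵖ (LinearMap.range f) ∈ WLower Λ T.1 := by
    refine ⟨range_mem T f hN, ?_⟩
    intro P hP g
    have h1 := hXk P hP ((LinearMap.range f).subtype ∘ₗ g)
    have h2 : LinearMap.ker ((LinearMap.range f).subtype ∘ₗ g) = LinearMap.ker g := by
      rw [LinearMap.ker_comp, Submodule.ker_subtype]
      rfl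
    rw [h2] at h1
    exact h1
  rcases hmin _ hW with h | h
  · exact absurd (LinearMap.range_eq_bot.1 h) hf
  · exact LinearMap.range_eq_top.1 h

theorem one_three [FiniteDimensional K Λ] [Finite (TorsionClass K Λ)] (T T' : TorsionClass K Λ)
    (hT : IsPopDown T' T) :
    ∀ X ∈ DSet Λ T.1, ∃ Z ∈ FiltSet Λ (USet Λ T.1),
        ∃ f : Z →ₗ[Λᵐᵒᵖ] X, Function.Surjective f := by
  let 𝓑 : Set (RMod Λ) := {B | ∃ S, S ⋖ T' ∧ IsLabel S T' B}
  have hTT' : T ≤ T' := hT.1 (Set.mem_insert _ _)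
  have hTS : ∀ S, S ⋖ T' → T ≤ S := fun S hS => hT.1 (Set.mem_insert_of_mem _ hS)
  have hmem : ∀ B ∈ 𝓑, B ∈ T'.1 := fun B ⟨S, hS, hB⟩ => hB.mem
  have hperp : ∀ B ∈ 𝓑, B ∈ Perp Λ T.1 := fun B ⟨S, hS, hB⟩ => perp_anti (hTS S hS) hB.perp
  have hsurj : ∀ B ∈ 𝓑, ∀ N ∈ T'.1, ∀ f : N →ₗ[Λᵐᵒᵖ] B, f ≠ 0 → Function.Surjective f :=
    fun B ⟨S, hS, hB⟩ => hB.surj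
  have hker : ∀ B ∈ 𝓑, ∀ N ∈ T'.1, ∀ f : N →ₗ[Λᵐᵒᵖ] B,
      ModuleCat.of Λᵐᵒᵖ (LinearMap.ker f) ∈ T'.1 := fun B ⟨S, hS, hB⟩ => hB.ker
  have hof : ∀ N ∈ T'.1, (∀ B ∈ 𝓑, ∀ f : N →ₗ[Λᵐᵒᵖ] B, f = 0) → N ∈ T.1 := by
    intro N hN h
    have h1 : interT T' {S | S ⋖ T'} ≤ T := by
      refine hT.2 ?_
      rintro S (rfl | hS)
      · exact fun M hM => hM.1
      · exact fun M hM => hM.2 S hS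
    refine h1 ⟨hN, fun S hS => ?_⟩
    obtain ⟨B, hB⟩ := exists_label (show S ⋖ T' from hS)
    exact hB.of_hom N hN (h B ⟨S, hS, hB⟩)
  have core := coker_core T T' 𝓑 hmem hperp hTT' hsurj hof hker
  -- labels belong to `𝒰(T)`
  have hBU : ∀ B ∈ 𝓑, B ∈ USet Λ T.1 := by
    intro B hB
    refine ⟨⟨hperp B hB, ?_⟩, ?_, ?_⟩
    · intro N hN f
      by_cases hf : f = 0
      · have h1 : LinearMap.range f = ⊥ := LinearMap.range_eq_bot.2 hf
        rw [h1]
        exact perp_inj (M := ModuleCat.of Λᵐᵒᵖ (N ⧸ (⊥ : Submodule Λᵐᵒᵖ N))) hN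
          (Submodule.quotEquivOfEqBot ⊥ rfl).toLinearMap
          (Submodule.quotEquivOfEqBot ⊥ rfl).injective
      · exact (core B hB N hN f hf).2
    · obtain ⟨S, hS, hB⟩ := hB
      exact hB.ne
    · intro N hN
      have h1 := hN.2 B (hperp B hB) N.subtype
      by_cases hz : (LinearMap.range N.subtype).mkQ = 0
      · right
        rw [eq_top_iff]
        intro x _
        obtain ⟨y, rfl⟩ := quot_range_zero (M := ModuleCat.of Λᵐᵒᵖ N) N.subtype hz x
        exact y.2
      · left
        have h2 := (core B hB _ h1 _ hz).1
        have h3 := injective_quot_range (M := ModuleCat.of Λᵐᵒᵖ N) N.subtype h2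
        rw [eq_bot_iff]
        intro x hx
        exact LinearMap.congr_fun h3 ⟨x, hx⟩
  -- modules of `T' ∩ T⊥` are filtered
  have hfilt : ∀ M ∈ T'.1, M ∈ Perp Λ T.1 → M ∈ FiltSet Λ (USet Λ T.1) := by
    intro M hM hMp
    have := artinian_of_mem T' hM
    refine filt_of_peel (𝒢 := {N | N ∈ T'.1 ∧ N ∈ Perp Λ T.1}) ?_ ⟨hM, hMp⟩ ?_
    · intro A B e hA
      exact ⟨T'.2.iso_closed A B e hA.1, perp_inj hA.2 e.symm.toLinearMap e.symm.injective⟩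
    · rintro N ⟨hN, hNp⟩ ⟨n, hn⟩
      have h1 : ∃ B ∈ 𝓑, ∃ f : N →ₗ[Λᵐᵒᵖ] B, f ≠ 0 := by
        by_contra! h
        exact hn (eq_zero_of_mem_perp (hof N hN h) hNp n)
      obtain ⟨B, hB, f, hf⟩ := h1
      exact ⟨B, hBU B hB, f, hf, hsurj B hB N hN f hf, hker B hB N hN f, perp_sub hNp _⟩
  -- nonzero modules of `T'` receive maps
  have hrec : ∀ Y ∈ T'.1, (∃ y : Y, y ≠ 0) →
      ∃ Z, Z ∈ T'.1 ∧ Z ∈ Perp Λ T.1 ∧ ∃ z : Z →ₗ[Λᵐᵒᵖ] Y, z ≠ 0 := by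
    rintro Y hY ⟨y, hy⟩
    by_contra! h
    let Q := leftPerp T' {N | ∀ Z, Z ∈ T'.1 → Z ∈ Perp Λ T.1 → ∀ f : Z →ₗ[Λᵐᵒᵖ] N, f = 0}
    have hYQ : Y ∉ Q.1 := fun h' => hy (LinearMap.congr_fun (h'.2 Y h LinearMap.id) y)
    have hQ : Q < T' := lt_of_le_not_ge (fun N hN => hN.1) (fun h' => hYQ (h' hY))
    obtain ⟨S, hQS, hS⟩ := exists_cover_below hQ
    obtain ⟨B, hB⟩ := exists_label hS
    obtain ⟨b, hb⟩ := hB.ne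
    have hBQ : B ∈ Q.1 :=
      ⟨hB.mem, fun N hN f => hN B hB.mem (perp_anti (hTS S hS) hB.perp) f⟩
    exact hb (eq_zero_of_mem_perp (hQS hBQ) hB.perp b)
  intro X hX
  have hXT' : X ∈ T'.1 := hTT' hX.1.1
  have := noetherian_of_mem T' hXT'
  have hsub : Subsingleton (⊥ : Submodule Λᵐᵒᵖ X) := inferInstance
  obtain ⟨I, ⟨hIT, hIp⟩, hmax⟩ := WellFounded.has_min
    (wellFounded_gt : WellFounded ((· > ·) : Submodule Λᵐᵒᵖ X → Submodule Λᵐᵒᵖ X → Prop))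
    {I | ModuleCat.of Λᵐᵒᵖ I ∈ T'.1 ∧ ModuleCat.of Λᵐᵒᵖ I ∈ Perp Λ T.1}
    ⟨⊥, T'.2.zero_mem (ModuleCat.of Λᵐᵒᵖ (⊥ : Submodule Λᵐᵒᵖ X)) hsub, by
      intro N hN f
      exact LinearMap.ext (fun x => hsub.elim (f x) 0)⟩
  have hQ : ∃ y : X ⧸ I, y ≠ 0 := by
    by_contra! h
    obtain ⟨x, hx⟩ := hX.2.1
    have h1 : ∀ x : X, x ∈ I := fun x => (Submodule.Quotient.mk_eq_zero I).1 (h _)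
    have h2 := hIp X hX.1.1 (LinearMap.id.codRestrict I h1)
    exact hx (congrArg Subtype.val (LinearMap.congr_fun h2 x))
  obtain ⟨Z, hZT, hZp, z, hz⟩ := hrec (ModuleCat.of Λᵐᵒᵖ (X ⧸ I))
    (T'.2.quot_closed X _ I.mkQ I.mkQ_surjective hXT') hQ
  let zz : Z →ₗ[Λᵐᵒᵖ] (X ⧸ I) := z
  let E : Submodule Λᵐᵒᵖ (Z × X) :=
    LinearMap.ker (zz ∘ₗ LinearMap.fst Λᵐᵒᵖ Z X - I.mkQ ∘ₗ LinearMap.snd Λᵐᵒᵖ Z X)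
  have hE : ∀ a x, (a, x) ∈ E ↔ zz a = I.mkQ x := fun a x => by
    rw [LinearMap.mem_ker]
    exact sub_eq_zero
  let p : E →ₗ[Λᵐᵒᵖ] Z := LinearMap.fst Λᵐᵒᵖ Z X ∘ₗ E.subtype
  let s : E →ₗ[Λᵐᵒᵖ] X := LinearMap.snd Λᵐᵒᵖ Z X ∘ₗ E.subtype
  have hp : Function.Surjective p := by
    intro a
    obtain ⟨x, hx⟩ := I.mkQ_surjective (zz a)
    exact ⟨⟨(a, x), (hE a x).2 hx.symm⟩, rfl⟩
  let i : I →ₗ[Λᵐᵒᵖ] E := (LinearMap.inr Λᵐᵒᵖ Z X ∘ₗ I.subtype).codRestrict E (fun x => by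
    refine (hE 0 x.1).2 ?_
    rw [map_zero]
    exact ((Submodule.Quotient.mk_eq_zero I).2 x.2).symm)
  have hpk : ∀ w : E, p w = 0 → s w ∈ I := by
    rintro ⟨⟨a, x⟩, hw⟩ h
    have h1 : a = 0 := h
    have h2 := (hE a x).1 hw
    rw [h1, map_zero] at h2
    exact (Submodule.Quotient.mk_eq_zero I).1 h2.symm
  have hET : ModuleCat.of Λᵐᵒᵖ E ∈ T'.1 := by
    refine ext_mem T' (A := ModuleCat.of Λᵐᵒᵖ I) (M := ModuleCat.of Λᵐᵒᵖ E) (N := Z) i p hp ?_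
      hIT hZT
    ext w
    rw [LinearMap.mem_ker, LinearMap.mem_range]
    constructor
    · rintro ⟨x, rfl⟩
      rfl
    · intro h
      refine ⟨⟨s w, hpk w h⟩, ?_⟩
      apply Subtype.ext
      exact Prod.ext (Eq.symm h) rfl
  have hEp : ModuleCat.of Λᵐᵒᵖ E ∈ Perp Λ T.1 := by
    refine perp_ext (N := ModuleCat.of Λᵐᵒᵖ E) hIp hZp p
      ((s ∘ₗ (LinearMap.ker p).subtype).codRestrict I (fun w => hpk w.1 w.2)) ?_
    rintro ⟨w, hw⟩ ⟨w', hw'⟩ h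
    have h1 : s w = s w' := congrArg Subtype.val h
    have h2 : p w = p w' := (LinearMap.mem_ker.1 hw).trans (LinearMap.mem_ker.1 hw').symm
    apply Subtype.ext
    apply Subtype.ext
    exact Prod.ext h2 h1
  refine ⟨ModuleCat.of Λᵐᵒᵖ E, hfilt _ hET hEp, s, ?_⟩
  have hJT : ModuleCat.of Λᵐᵒᵖ (LinearMap.range s) ∈ T'.1 :=
    range_mem T' (M := ModuleCat.of Λᵐᵒᵖ E) s hET
  have hIJ : I ≤ LinearMap.range s := fun x hx => ⟨i ⟨x, hx⟩, rfl⟩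
  have hJp : ModuleCat.of Λᵐᵒᵖ (LinearMap.range s) ∉ Perp Λ T.1 := by
    intro h
    have hJI : LinearMap.range s = I := by
      by_contra hne
      exact hmax _ ⟨hJT, h⟩ (lt_of_le_of_ne hIJ (Ne.symm hne))
    apply hz
    ext a
    obtain ⟨⟨⟨a', x⟩, hw⟩, rfl⟩ := hp a
    have h1 : x ∈ LinearMap.range s := ⟨⟨(a', x), hw⟩, rfl⟩
    rw [hJI] at h1
    exact ((hE a' x).1 hw).trans ((Submodule.Quotient.mk_eq_zero I).2 h1)
  have h1 : ∃ M ∈ T.1, ∃ f : M →ₗ[Λᵐᵒᵖ] LinearMap.range s, f ≠ 0 := by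
    by_contra! h
    exact hJp h
  obtain ⟨M, hM, f, hf⟩ := h1
  have hf' : (LinearMap.range s).subtype ∘ₗ f ≠ 0 := fun h => hf (by
    ext x
    exact LinearMap.congr_fun h x)
  have h2 := dset_surj T hX M hM _ hf'
  intro x
  obtain ⟨y, rfl⟩ := h2 x
  exact (f y).2

end Helpers

/-- Let `Λ` be a τ-tilting finite finite-dimensional `K`-algebra and `𝒯` a
torsion class.  The following are equivalent: (1) `𝒯` lies in the image of `pop↓`;
(2) `pop↓(pop↑(𝒯)) = 𝒯`; (3) every `X ∈ 𝒟(𝒯)` admits a surjection from some module of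
`Filt(𝒰(𝒯))`. -/
theorem stmt1 [FiniteDimensional K Λ] (hfin : Finite (TorsionClass K Λ))
    (T : TorsionClass K Λ) :
    ((∃ T' : TorsionClass K Λ, IsPopDown T' T) ↔
      (∃ T₁ : TorsionClass K Λ, IsPopUp T T₁ ∧ IsPopDown T₁ T)) ∧
    ((∃ T' : TorsionClass K Λ, IsPopDown T' T) ↔
      (∀ X ∈ DSet Λ T.1, ∃ Z ∈ FiltSet Λ (USet Λ T.1),
        ∃ f : Z →ₗ[Λᵐᵒᵖ] X, Function.Surjective f)) := by
  have := hfin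
  have h12 : (∃ T₁ : TorsionClass K Λ, IsPopUp T T₁ ∧ IsPopDown T₁ T) →
      (∃ T' : TorsionClass K Λ, IsPopDown T' T) := fun ⟨T₁, _, h⟩ => ⟨T₁, h⟩
  refine ⟨⟨fun ⟨T', h⟩ => three_two T (one_three T T' h), h12⟩,
    ⟨fun ⟨T', h⟩ => one_three T T' h, fun h => h12 (three_two T h)⟩⟩

end PaperTors
end
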